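/- arXiv:1806.01075 — 3 statements merged into one kernel-verified Lean document; each statement's English description precedes it below -/
import Mathlib

section
/- Fix constants l > 0, g > 0, μ > 0 and a Lipschitz continuous function a : ℝ → ℝ. Then for every initial condition (q₀,p₀) and every initial time t₀, there exists a solution (q(t),p(t)) of the pendulum differential inclusion (q̇,ṗ) ∈ Φ(q,p,t) defined on all of [t₀,∞) with q(t₀) = q₀ and p(t₀) = p₀. -/
open MeasureTheory Set Filter

noncomputable section

/-- The scalar right-hand side of the pendulum equation for the angular velocity, where
`s ∈ [-1, 1]` is the direction of the dry friction force:
`h (q, p, t, s) = (a t / l)·sin q − (μ / l)·|a t·cos q − l·p² + g·sin q|·s − (g / l)·cos q`. -/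
def hRHS (l g μ : ℝ) (a : ℝ → ℝ) (q p t s : ℝ) : ℝ :=
  (a t / l) * Real.sin q - (μ / l) * |a t * Real.cos q - l * p ^ 2 + g * Real.sin q| * s
    - (g / l) * Real.cos q

/-- The pendulum set-valued map `Φ`: a singleton `{(p, h (q, p, t, p / |p|))}` for `p ≠ 0`,
and the segment `{(0, h (q, 0, t, s)) : s ∈ [−1, 1]}` for `p = 0`. -/
def Phi (l g μ : ℝ) (a : ℝ → ℝ) (q p t : ℝ) : Set (ℝ × ℝ) :=
  if p ≠ 0 then {(p, hRHS l g μ a q p t (p / |p|))}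
  else {v : ℝ × ℝ | ∃ s ∈ Set.Icc (-1 : ℝ) 1, v = (0, hRHS l g μ a q 0 t s)}

/-- `x` is a solution of the differential inclusion `ẋ ∈ F (x, t)` (in the plane) on the
time interval `I` containing `t₀`: there is a locally integrable `v` with
`x t = x t₀ + ∫_{t₀}^t v` on `I` and `v t ∈ F (x t) t` for a.e. `t ∈ I`. -/
def IsDISolution (F : ℝ × ℝ → ℝ → Set (ℝ × ℝ)) (I : Set ℝ) (t₀ : ℝ)
    (x : ℝ → ℝ × ℝ) : Prop :=
  ∃ v : ℝ → ℝ × ℝ, LocallyIntegrable v volume ∧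
    (∀ t ∈ I, x t = x t₀ + ∫ s in t₀..t, v s) ∧
    (∀ᵐ t ∂(volume.restrict I), v t ∈ F (x t) t)


/-- Bounded and Lipschitz in the second variable, uniformly for times in `S`. -/
def BL (S : Set ℝ) (f : ℝ → ℝ × ℝ → ℝ) : Prop :=
  ∃ C : ℝ, 0 ≤ C ∧ ∀ t ∈ S, ∀ z w : ℝ × ℝ, |f t z| ≤ C ∧ |f t z - f t w| ≤ C * ‖z - w‖

lemma BL.add {S : Set ℝ} {f g : ℝ → ℝ × ℝ → ℝ} (hf : BL S f) (hg : BL S g) :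
    BL S (fun t z => f t z + g t z) := by
  obtain ⟨C, hC, h1⟩ := hf
  obtain ⟨D, hD, h2⟩ := hg
  refine ⟨C + D, by positivity, fun t ht z w => ?_⟩
  obtain ⟨a1, a2⟩ := h1 t ht z w
  obtain ⟨b1, b2⟩ := h2 t ht z w
  constructor
  · exact (abs_add_le _ _).trans (by linarith)
  · calc |f t z + g t z - (f t w + g t w)| = |(f t z - f t w) + (g t z - g t w)| := by ring_nf
      _ ≤ _ := abs_add_le _ _
      _ ≤ _ := by linarith

lemma BL.mul {S : Set ℝ} {f g : ℝ → ℝ × ℝ → ℝ} (hf : BL S f) (hg : BL S g) :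
    BL S (fun t z => f t z * g t z) := by
  obtain ⟨C, hC, h1⟩ := hf
  obtain ⟨D, hD, h2⟩ := hg
  refine ⟨2 * C * D, by positivity, fun t ht z w => ?_⟩
  obtain ⟨a1, a2⟩ := h1 t ht z w
  obtain ⟨b1, b2⟩ := h2 t ht z w
  obtain ⟨b3, -⟩ := h2 t ht w w
  constructor
  · rw [abs_mul]
    have := mul_le_mul a1 b1 (abs_nonneg _) hC
    nlinarith [mul_nonneg hC hD]
  · calc |f t z * g t z - f t w * g t w|
        = |f t z * (g t z - g t w) + (f t z - f t w) * g t w| := by ring_nf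
      _ ≤ _ := abs_add_le _ _
      _ ≤ C * (D * ‖z - w‖) + (C * ‖z - w‖) * D := by
        rw [abs_mul, abs_mul]
        gcongr
      _ = _ := by ring

lemma BL.abs {S : Set ℝ} {f : ℝ → ℝ × ℝ → ℝ} (hf : BL S f) : BL S (fun t z => |f t z|) := by
  obtain ⟨C, hC, h1⟩ := hf
  refine ⟨C, hC, fun t ht z w => ?_⟩
  obtain ⟨a1, a2⟩ := h1 t ht z w
  exact ⟨by simpa using a1, (abs_abs_sub_abs_le _ _).trans a2⟩

lemma BL.const {S : Set ℝ} (f : ℝ → ℝ) {C : ℝ} (hC : 0 ≤ C) (h : ∀ t ∈ S, |f t| ≤ C) :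
    BL S (fun t _ => f t) :=
  ⟨C, hC, fun t ht z w => ⟨h t ht, by simp; positivity⟩⟩

lemma BL.of_fun {S : Set ℝ} (f : ℝ × ℝ → ℝ) {C D : ℝ} (hC : 0 ≤ C) (hD : 0 ≤ D)
    (h : ∀ z, |f z| ≤ C) (h' : ∀ z w, |f z - f w| ≤ D * ‖z - w‖) :
    BL S (fun _ z => f z) :=
  ⟨C + D, by positivity, fun t ht z w => ⟨(h z).trans (by linarith),
    (h' z w).trans (by gcongr; linarith)⟩⟩

def clamp (R x : ℝ) : ℝ := max (-R) (min R x)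

lemma clamp_abs_le {R : ℝ} (hR : 0 ≤ R) (x : ℝ) : |clamp R x| ≤ R := by
  unfold clamp
  rw [abs_le]
  constructor
  · exact le_max_left _ _
  · exact max_le (by linarith) (min_le_left _ _)

lemma clamp_lip (R x y : ℝ) : |clamp R x - clamp R y| ≤ |x - y| := by
  unfold clamp
  refine (abs_max_sub_max_le_max _ _ _ _).trans ?_
  simp only [sub_self, abs_zero]
  refine max_le (abs_nonneg _) ((abs_min_sub_min_le_max _ _ _ _).trans ?_)
  simp

lemma clamp_eq {R x : ℝ} (h : |x| ≤ R) : clamp R x = x := by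
  unfold clamp
  rw [abs_le] at h
  rw [min_eq_right h.2, max_eq_right h.1]

lemma clamp_nonneg {R x : ℝ} (hR : 0 ≤ R) (h : 0 ≤ x) : 0 ≤ clamp R x :=
  le_max_of_le_right (le_min hR h)

lemma clamp_nonpos {R x : ℝ} (hR : 0 ≤ R) (h : x ≤ 0) : clamp R x ≤ 0 :=
  max_le (by linarith) (min_le_of_right_le h)

lemma clamp_eq_top {R x : ℝ} (hR : 0 ≤ R) (h : R ≤ x) : clamp R x = R := by
  unfold clamp
  rw [min_eq_left h, max_eq_right (by linarith)]

lemma clamp_eq_bot {R x : ℝ} (h : x ≤ -R) : clamp R x = -R := by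
  unfold clamp
  exact max_eq_left ((min_le_right _ _).trans h)

/-- regularised field -/
def fld (l g μ : ℝ) (a : ℝ → ℝ) (n : ℕ) (t : ℝ) (z : ℝ × ℝ) : ℝ × ℝ :=
  (clamp n z.2, hRHS l g μ a z.1 (clamp n z.2) t (clamp 1 (n * z.2)))

lemma BL_fld (l g μ : ℝ) (a : ℝ → ℝ) (n : ℕ) {S : Set ℝ} {A : ℝ} (hA : 0 ≤ A)
    (ha : ∀ t ∈ S, |a t| ≤ A) :
    BL S (fun t z => (fld l g μ a n t z).1) ∧ BL S (fun t z => (fld l g μ a n t z).2) := by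
  have n0 : (0 : ℝ) ≤ n := Nat.cast_nonneg n
  have e1 : ∀ z w : ℝ × ℝ, |z.1 - w.1| ≤ ‖z - w‖ := fun z w => norm_fst_le (z - w)
  have e2 : ∀ z w : ℝ × ℝ, |z.2 - w.2| ≤ ‖z - w‖ := fun z w => norm_snd_le (z - w)
  have hc : BL S (fun _ z => clamp n z.2) :=
    BL.of_fun (fun z => clamp n z.2) n0 zero_le_one (fun z => clamp_abs_le n0 _)
      (fun z w => (clamp_lip _ _ _).trans (by simpa using e2 z w))
  have hs : BL S (fun _ z => clamp 1 (n * z.2)) :=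
    BL.of_fun (fun z => clamp 1 (n * z.2)) zero_le_one n0 (fun z => clamp_abs_le zero_le_one _)
      (fun z w => (clamp_lip _ _ _).trans (by
        rw [← mul_sub, abs_mul, abs_of_nonneg n0]
        exact mul_le_mul_of_nonneg_left (e2 z w) n0))
  have hsin : BL S (fun _ z => Real.sin z.1) :=
    BL.of_fun (fun z => Real.sin z.1) zero_le_one zero_le_one (fun z => Real.abs_sin_le_one _)
      (fun z w => (Real.abs_sin_sub_sin_le _ _).trans (by simpa using e1 z w))
  have hcos : BL S (fun _ z => Real.cos z.1) :=
    BL.of_fun (fun z => Real.cos z.1) zero_le_one zero_le_one (fun z => Real.abs_cos_le_one _)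
      (fun z w => (Real.abs_cos_sub_cos_le _ _).trans (by simpa using e1 z w))
  have hcst : ∀ c : ℝ, BL S (fun _ _ => c) := fun c =>
    BL.const (fun _ => c) (abs_nonneg c) (fun _ _ => le_rfl)
  have hat : BL S (fun t _ => a t) := BL.const a hA ha
  refine ⟨hc, ?_⟩
  have := (((hat.mul (hcst l⁻¹)).mul hsin).add ((((hcst (-(μ / l))).mul
    (((hat.mul hcos).add ((hcst (-l)).mul (hc.mul hc))).add ((hcst g).mul hsin)).abs).mul hs))).add
      ((hcst (-(g / l))).mul hcos)
  convert this using 3 with t z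
  simp only [fld, hRHS]
  ring_nf

lemma exists_approx (l g μ : ℝ) (a : ℝ → ℝ) (K : NNReal) (ha : LipschitzWith K a)
    (x₀ : ℝ × ℝ) (t₀ : ℝ) (n : ℕ) :
    ∃ α : ℝ → ℝ × ℝ, α t₀ = x₀ ∧ ∀ t ∈ Icc t₀ (t₀ + n),
      HasDerivWithinAt α (fld l g μ a n t (α t)) (Icc t₀ (t₀ + n)) t := by
  have n0 : (0 : ℝ) ≤ n := Nat.cast_nonneg n
  obtain ⟨A, hA⟩ := (isCompact_Icc (a := t₀) (b := t₀ + n)).exists_bound_of_continuousOn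
    ha.continuous.continuousOn
  have hA' : ∀ t ∈ Icc t₀ (t₀ + n), |a t| ≤ |A| := fun t ht => (hA t ht).trans (le_abs_self A)
  obtain ⟨⟨C, hC, h1⟩, ⟨D, hD, h2⟩⟩ := BL_fld l g μ a n (abs_nonneg A) hA'
  let L : NNReal := ⟨max C D, hC.trans (le_max_left _ _)⟩
  have hpl : IsPicardLindelof (fld l g μ a n) (tmin := t₀) (tmax := t₀ + n)
      ⟨t₀, by simp⟩ x₀ (L * n) 0 L L := by
    refine ⟨fun t ht => ?_, fun x _ => ?_, fun t ht x _ => ?_, ?_⟩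
    · apply LipschitzWith.lipschitzOnWith
      apply LipschitzWith.of_dist_le_mul
      intro z w
      rw [dist_eq_norm, dist_eq_norm, Prod.norm_def]
      refine max_le ((h1 t ht z w).2.trans ?_) ((h2 t ht z w).2.trans ?_)
      · gcongr; exact le_max_left C D
      · gcongr; exact le_max_right C D
    · have := ha.continuous
      unfold fld hRHS
      fun_prop
    · rw [Prod.norm_def]
      refine max_le ((h1 t ht x x).1.trans (le_max_left C D))
        ((h2 t ht x x).1.trans (le_max_right C D))
    · simp
  obtain ⟨α, h⟩ := hpl.exists_eq_forall_mem_Icc_hasDerivWithinAt₀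
  exact ⟨α, h⟩

lemma base_abs_le {l g : ℝ} (hl : 0 < l) (hg : 0 < g) (b q : ℝ) :
    |b / l * Real.sin q - g / l * Real.cos q| ≤ (|b| + g) / l := by
  have h1 : |b / l * Real.sin q| ≤ |b| / l := by
    rw [abs_mul, abs_div, abs_of_pos hl]
    exact mul_le_of_le_one_right (by positivity) (Real.abs_sin_le_one q)
  have h2 : |g / l * Real.cos q| ≤ g / l := by
    rw [abs_mul, abs_div, abs_of_pos hl, abs_of_pos hg]
    exact mul_le_of_le_one_right (by positivity) (Real.abs_cos_le_one q)
  have := abs_sub (b / l * Real.sin q) (g / l * Real.cos q)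
  rw [add_div]
  linarith

lemma hRHS_eq (l g μ : ℝ) (a : ℝ → ℝ) (q p t s : ℝ) : hRHS l g μ a q p t s =
    (a t / l * Real.sin q - g / l * Real.cos q)
      - (μ / l) * |a t * Real.cos q - l * p ^ 2 + g * Real.sin q| * s := by
  unfold hRHS; ring

lemma hRHS_anti {l μ : ℝ} (hl : 0 < l) (hμ : 0 < μ) (g : ℝ) (a : ℝ → ℝ) (q p t : ℝ) {s s' : ℝ}
    (h : s ≤ s') : hRHS l g μ a q p t s' ≤ hRHS l g μ a q p t s := by
  rw [hRHS_eq, hRHS_eq]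
  gcongr

lemma hRHS_le {l g μ : ℝ} (hl : 0 < l) (hg : 0 < g) (hμ : 0 < μ) (a : ℝ → ℝ) (q p t : ℝ) {s : ℝ}
    (h : 0 ≤ s) : hRHS l g μ a q p t s ≤ (|a t| + g) / l := by
  refine (hRHS_anti hl hμ g a q p t h).trans ?_
  rw [hRHS_eq]
  have := (abs_le.1 (base_abs_le hl hg (a t) q)).2
  linarith

lemma le_hRHS {l g μ : ℝ} (hl : 0 < l) (hg : 0 < g) (hμ : 0 < μ) (a : ℝ → ℝ) (q p t : ℝ) {s : ℝ}
    (h : s ≤ 0) : -((|a t| + g) / l) ≤ hRHS l g μ a q p t s := by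
  refine le_trans ?_ (hRHS_anti hl hμ g a q p t h)
  rw [hRHS_eq]
  have := (abs_le.1 (base_abs_le hl hg (a t) q)).1
  linarith

lemma hRHS_abs {l g μ : ℝ} (hl : 0 < l) (hg : 0 < g) (hμ : 0 < μ) (a : ℝ → ℝ) (q p t s A B : ℝ)
    (hs : |s| ≤ 1) (hA : |a t| ≤ A) (hB : |p| ≤ B) :
    |hRHS l g μ a q p t s| ≤ (A + g) / l + μ / l * (A + l * B ^ 2 + g) := by
  rw [hRHS_eq]
  refine (abs_sub _ _).trans (add_le_add ((base_abs_le hl hg (a t) q).trans (by gcongr)) ?_)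
  rw [abs_mul, abs_mul, abs_abs, abs_of_pos (div_pos hμ hl)]
  refine (mul_le_of_le_one_right (by positivity) hs).trans ?_
  gcongr
  have h1 : |a t * Real.cos q| ≤ A := by
    rw [abs_mul]
    exact (mul_le_of_le_one_right (abs_nonneg _) (Real.abs_cos_le_one q)).trans hA
  have h2 : |g * Real.sin q| ≤ g := by
    rw [abs_mul, abs_of_pos hg]
    exact mul_le_of_le_one_right hg.le (Real.abs_sin_le_one q)
  have h3 : |l * p ^ 2| ≤ l * B ^ 2 := by
    rw [abs_mul, abs_of_pos hl, abs_pow]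
    gcongr
  have h4 := abs_add_le (a t * Real.cos q - l * p ^ 2) (g * Real.sin q)
  have h5 := abs_sub (a t * Real.cos q) (l * p ^ 2)
  linarith

lemma approx_bound {l g μ : ℝ} (hl : 0 < l) (hg : 0 < g) (hμ : 0 < μ)
    (a : ℝ → ℝ) (q₀ p₀ t₀ : ℝ) (n : ℕ) {α : ℝ → ℝ × ℝ} (h0 : α t₀ = (q₀, p₀))
    {T A : ℝ} (hT : 0 ≤ T) (hTn : T ≤ n) (hA : ∀ t ∈ Icc t₀ (t₀ + T), |a t| ≤ A)
    (hα : ∀ t ∈ Icc t₀ (t₀ + n),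
      HasDerivWithinAt α (fld l g μ a n t (α t)) (Icc t₀ (t₀ + n)) t) :
    ∀ t ∈ Icc t₀ (t₀ + T), |(α t).2| ≤ |p₀| + 1 + ((A + g) / l + 1) * T := by
  have hA0 : 0 ≤ A := (abs_nonneg _).trans (hA t₀ (by simp [hT]))
  have n0 : (0 : ℝ) ≤ n := Nat.cast_nonneg n
  set M := (A + g) / l + 1 with hM
  have hMpos : 0 ≤ M := by positivity
  have hsub : Icc t₀ (t₀ + T) ⊆ Icc t₀ (t₀ + n) := Icc_subset_Icc le_rfl (by linarith)
  have hp : ∀ t ∈ Icc t₀ (t₀ + n),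
      HasDerivWithinAt (fun t => (α t).2) (fld l g μ a n t (α t)).2 (Icc t₀ (t₀ + n)) t :=
    fun t ht => (hα t ht).snd
  have hpc : ContinuousOn (fun t => (α t).2) (Icc t₀ (t₀ + T)) := fun t ht =>
    (hp t (hsub ht)).continuousWithinAt.mono hsub
  have hpr : ∀ t ∈ Ico t₀ (t₀ + T),
      HasDerivWithinAt (fun t => (α t).2) (fld l g μ a n t (α t)).2 (Ici t) t := fun t ht =>
    (hp t (hsub ⟨ht.1, ht.2.le⟩)).mono_of_mem_nhdsWithin
      (mem_of_superset (Icc_mem_nhdsGE (show t < t₀ + n by linarith [ht.2]))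
        (Icc_subset_Icc ht.1 le_rfl))
  have hB : ∀ x, HasDerivAt (fun x => |p₀| + 1 + M * (x - t₀)) M x := fun x => by
    simpa using (((hasDerivAt_id x).sub_const t₀).const_mul M).const_add (|p₀| + 1)
  have hF : ∀ x ∈ Ico t₀ (t₀ + T), (|a x| + g) / l < M := fun x hx => by
    have : (|a x| + g) / l ≤ (A + g) / l := by
      gcongr; exact hA x ⟨hx.1, hx.2.le⟩
    linarith
  have up := image_le_of_deriv_right_lt_deriv_boundary hpc hpr
    (B := fun x => |p₀| + 1 + M * (x - t₀)) (B' := fun _ => M)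
    (by simp only [h0]; linarith [le_abs_self p₀, mul_nonneg hMpos (sub_self t₀).ge]) hB
    (by
      intro x hx hxe
      have hpos : 0 ≤ (α x).2 := by
        rw [hxe]
        have := mul_nonneg hMpos (sub_nonneg.2 hx.1)
        positivity
      exact (hRHS_le hl hg hμ a _ _ _ (clamp_nonneg zero_le_one (mul_nonneg n0 hpos))).trans_lt
        (hF x hx))
  have dn := image_le_of_deriv_right_lt_deriv_boundary (f := fun t => -(α t).2)
    hpc.neg (fun t ht => (hpr t ht).neg)
    (B := fun x => |p₀| + 1 + M * (x - t₀)) (B' := fun _ => M)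
    (by simp only [h0]; linarith [neg_abs_le p₀, mul_nonneg hMpos (sub_self t₀).ge]) hB
    (by
      intro x hx hxe
      have hpos : (α x).2 ≤ 0 := by
        have := mul_nonneg hMpos (sub_nonneg.2 hx.1)
        have := abs_nonneg p₀
        linarith
      have := (le_hRHS hl hg hμ a (α x).1 (clamp n (α x).2) x
        (clamp_nonpos zero_le_one (mul_nonpos_of_nonneg_of_nonpos n0 hpos)))
      have h2 := hF x hx
      show - hRHS _ _ _ _ _ _ _ _ < _
      linarith)
  intro t ht
  have hmt : M * (t - t₀) ≤ M * T := by gcongr; linarith [ht.2]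
  have h1 := up ht
  have h2 := dn ht
  rw [abs_le]
  constructor <;> linarith

lemma exists_family {l g μ : ℝ} (hl : 0 < l) (hg : 0 < g) (hμ : 0 < μ)
    (a : ℝ → ℝ) (K : NNReal) (ha : LipschitzWith K a) (q₀ p₀ t₀ : ℝ) :
    ∃ Q P : ℕ → ℝ → ℝ, (∀ n, Q n t₀ = q₀) ∧ (∀ n, P n t₀ = p₀) ∧
      ∀ T : ℝ, 0 ≤ T → ∃ L : ℝ, 0 ≤ L ∧ ∀ᶠ n : ℕ in atTop,
        (∀ s ∈ Icc t₀ (t₀ + T), ∀ u ∈ Icc t₀ (t₀ + T),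
          |Q n s - Q n u| ≤ L * |s - u| ∧ |P n s - P n u| ≤ L * |s - u|) ∧
        ∀ s ∈ Ioo t₀ (t₀ + T), HasDerivAt (Q n) (P n s) s ∧
          HasDerivAt (P n) (hRHS l g μ a (Q n s) (P n s) s (clamp 1 (n * P n s))) s := by
  choose α h0 hα using exists_approx l g μ a K ha (q₀, p₀) t₀
  refine ⟨fun n t => (α n t).1, fun n t => (α n t).2, fun n => by simp [h0],
    fun n => by simp [h0], fun T hT => ?_⟩
  obtain ⟨A, hA⟩ := (isCompact_Icc (a := t₀) (b := t₀ + T)).exists_bound_of_continuousOn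
    ha.continuous.continuousOn
  have hA0 : 0 ≤ A := (norm_nonneg _).trans (hA t₀ (by simp [hT]))
  set B := |p₀| + 1 + ((A + g) / l + 1) * T with hB
  have hB0 : 0 ≤ B := by positivity
  set L := B + ((A + g) / l + μ / l * (A + l * B ^ 2 + g)) with hL
  have hL1 : B ≤ L := le_add_of_nonneg_right (by positivity)
  have hL2 : (A + g) / l + μ / l * (A + l * B ^ 2 + g) ≤ L := le_add_of_nonneg_left hB0
  refine ⟨L, by positivity, ?_⟩
  have e1 : ∀ᶠ n : ℕ in atTop, T ≤ n := tendsto_natCast_atTop_atTop.eventually_ge_atTop T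
  have e2 : ∀ᶠ n : ℕ in atTop, B ≤ n := tendsto_natCast_atTop_atTop.eventually_ge_atTop B
  filter_upwards [e1, e2] with n hn1 hn2
  have hb := approx_bound hl hg hμ a q₀ p₀ t₀ n (h0 n) hT hn1 hA (hα n)
  have hsub : Icc t₀ (t₀ + T) ⊆ Icc t₀ (t₀ + n) := Icc_subset_Icc le_rfl (by linarith)
  have hcl : ∀ t ∈ Icc t₀ (t₀ + T), clamp n (α n t).2 = (α n t).2 := fun t ht =>
    clamp_eq ((hb t ht).trans hn2)
  have hd1 : ∀ t ∈ Icc t₀ (t₀ + T),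
      HasDerivWithinAt (fun t => (α n t).1) (α n t).2 (Icc t₀ (t₀ + T)) t := fun t ht => by
    have : HasDerivWithinAt (fun t => (α n t).1) (fld l g μ a n t (α n t)).1 (Icc t₀ (t₀ + T)) t :=
      ((hα n t (hsub ht)).mono hsub).fst
    simpa only [fld, hcl t ht] using this
  have hd2 : ∀ t ∈ Icc t₀ (t₀ + T),
      HasDerivWithinAt (fun t => (α n t).2) (hRHS l g μ a (α n t).1 (α n t).2 t
        (clamp 1 (n * (α n t).2))) (Icc t₀ (t₀ + T)) t := fun t ht => by
    have : HasDerivWithinAt (fun t => (α n t).2) (fld l g μ a n t (α n t)).2 (Icc t₀ (t₀ + T)) t :=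
      ((hα n t (hsub ht)).mono hsub).snd
    simpa only [fld, hcl t ht] using this
  refine ⟨fun s hs u hu => ⟨?_, ?_⟩, fun s hs => ⟨?_, ?_⟩⟩
  · exact (convex_Icc t₀ (t₀ + T)).norm_image_sub_le_of_norm_hasDerivWithin_le
      (f := fun t => (α n t).1) hd1 (fun t ht => (hb t ht).trans hL1) hu hs
  · exact (convex_Icc t₀ (t₀ + T)).norm_image_sub_le_of_norm_hasDerivWithin_le
      (f := fun t => (α n t).2) hd2 (fun t ht => (hRHS_abs hl hg hμ a _ _ t _ A B
        (clamp_abs_le zero_le_one _) (hA t ht) (hb t ht)).trans hL2) hu hs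
  · exact (hd1 s ⟨hs.1.le, hs.2.le⟩).hasDerivAt (Icc_mem_nhds hs.1 hs.2)
  · exact (hd2 s ⟨hs.1.le, hs.2.le⟩).hasDerivAt (Icc_mem_nhds hs.1 hs.2)

open Topology in
lemma deriv_ge_of_lim {U : Ultrafilter ℕ} {u : ℕ → ℝ → ℝ} {w : ℝ → ℝ} {t A d : ℝ}
    (hw : HasDerivAt w d t) (hlim : ∀ s, t ≤ s → Tendsto (fun n => u n s) U (𝓝 (w s)))
    (h : ∀ ε > 0, ∃ δ > 0, ∀ᶠ n in (U : Filter ℕ), ∀ s ∈ Icc t (t + δ),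
      ∃ e, HasDerivAt (u n) e s ∧ A - ε ≤ e) : A ≤ d := by
  apply le_of_forall_pos_sub_le
  intro ε hε
  obtain ⟨δ, hδ, hn⟩ := h ε hε
  have key : ∀ s ∈ Ioo t (t + δ), (A - ε) * (s - t) ≤ w s - w t := by
    intro s hs
    refine ge_of_tendsto ((hlim s hs.1.le).sub (hlim t le_rfl)) ?_
    filter_upwards [hn] with n hn
    refine (convex_Icc t (t + δ)).mul_sub_le_image_sub_of_le_deriv ?_ ?_ ?_ t
      ⟨le_rfl, by linarith⟩ s ⟨hs.1.le, hs.2.le⟩ hs.1.le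
    · intro x hx
      obtain ⟨e, he, -⟩ := hn x hx
      exact he.continuousAt.continuousWithinAt
    · intro x hx
      obtain ⟨e, he, -⟩ := hn x (interior_subset hx)
      exact he.differentiableAt.differentiableWithinAt
    · intro x hx
      obtain ⟨e, he, h2⟩ := hn x (interior_subset hx)
      rwa [he.deriv]
  have hsl : Tendsto (slope w t) (𝓝[>] t) (𝓝 d) :=
    (hasDerivAt_iff_tendsto_slope.1 hw).mono_left
      (nhdsWithin_mono _ (fun x hx => ne_of_gt hx))
  refine ge_of_tendsto hsl ?_
  filter_upwards [Ioo_mem_nhdsGT (show t < t + δ by linarith)] with s hs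
  rw [slope_def_field, le_div_iff₀ (sub_pos.2 hs.1)]
  exact key s hs

open Topology in
lemma deriv_le_of_lim {U : Ultrafilter ℕ} {u : ℕ → ℝ → ℝ} {w : ℝ → ℝ} {t A d : ℝ}
    (hw : HasDerivAt w d t) (hlim : ∀ s, t ≤ s → Tendsto (fun n => u n s) U (𝓝 (w s)))
    (h : ∀ ε > 0, ∃ δ > 0, ∀ᶠ n in (U : Filter ℕ), ∀ s ∈ Icc t (t + δ),
      ∃ e, HasDerivAt (u n) e s ∧ e ≤ A + ε) : d ≤ A := by
  have := deriv_ge_of_lim (U := U) (u := fun n s => - u n s) (w := fun s => - w s) (A := -A)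
    hw.fun_neg (fun s hs => (hlim s hs).neg) (by
      intro ε hε
      obtain ⟨δ, hδ, hn⟩ := h ε hε
      refine ⟨δ, hδ, ?_⟩
      filter_upwards [hn] with n hn s hs
      obtain ⟨e, he, h2⟩ := hn s hs
      exact ⟨-e, he.fun_neg, by linarith⟩)
  linarith

open Topology in
lemma exists_limit {l g μ : ℝ} (hl : 0 < l) (hg : 0 < g) (hμ : 0 < μ)
    (a : ℝ → ℝ) (K : NNReal) (ha : LipschitzWith K a) (q₀ p₀ t₀ : ℝ) :
    ∃ q p : ℝ → ℝ, q t₀ = q₀ ∧ p t₀ = p₀ ∧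
      (∀ T : ℝ, 0 ≤ T → ∃ L : ℝ, 0 ≤ L ∧ ∀ s ∈ Icc t₀ (t₀ + T), ∀ u ∈ Icc t₀ (t₀ + T),
          |q s - q u| ≤ L * |s - u| ∧ |p s - p u| ≤ L * |s - u|) ∧
      ∀ t, t₀ < t → ∀ dq dp, HasDerivAt q dq t → HasDerivAt p dp t →
        (dq, dp) ∈ Phi l g μ a (q t) (p t) t := by
  obtain ⟨Q, P, hQ0, hP0, hfam⟩ := exists_family hl hg hμ a K ha q₀ p₀ t₀
  let U : Ultrafilter ℕ := hyperfilter ℕ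
  have hU : (U : Filter ℕ) ≤ atTop := Nat.hyperfilter_le_atTop
  have gen : ∀ (u : ℕ → ℝ) (c R : ℝ), (∀ᶠ n in (U : Filter ℕ), |u n - c| ≤ R) →
      ∃ y, Tendsto u U (𝓝 y) := by
    intro u c R h
    obtain ⟨y, -, hy⟩ := (isCompact_Icc (a := c - R) (b := c + R)).ultrafilter_le_nhds (U.map u)
      (by
        rw [le_principal_iff]
        show ∀ᶠ n in (U : Filter ℕ), u n ∈ Icc (c - R) (c + R)
        filter_upwards [h] with n hn
        rw [abs_le] at hn
        exact ⟨by linarith, by linarith⟩)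
    exact ⟨y, hy⟩
  have hq : ∀ s, ∃ y, t₀ ≤ s → Tendsto (fun n => Q n s) U (𝓝 y) := by
    intro s
    by_cases hs : t₀ ≤ s
    · obtain ⟨L, hL, h⟩ := hfam (s - t₀) (by linarith)
      obtain ⟨y, hy⟩ := gen (fun n => Q n s) q₀ (L * |s - t₀|) (by
        filter_upwards [hU h] with n hn
        have := (hn.1 s ⟨hs, by linarith⟩ t₀ ⟨le_rfl, by linarith⟩).1
        rwa [hQ0] at this)
      exact ⟨y, fun _ => hy⟩
    · exact ⟨0, fun h => absurd h hs⟩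
  have hp : ∀ s, ∃ y, t₀ ≤ s → Tendsto (fun n => P n s) U (𝓝 y) := by
    intro s
    by_cases hs : t₀ ≤ s
    · obtain ⟨L, hL, h⟩ := hfam (s - t₀) (by linarith)
      obtain ⟨y, hy⟩ := gen (fun n => P n s) p₀ (L * |s - t₀|) (by
        filter_upwards [hU h] with n hn
        have := (hn.1 s ⟨hs, by linarith⟩ t₀ ⟨le_rfl, by linarith⟩).2
        rwa [hP0] at this)
      exact ⟨y, fun _ => hy⟩
    · exact ⟨0, fun h => absurd h hs⟩
  choose q hq using hq
  choose p hp using hp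
  refine ⟨q, p, ?_, ?_, ?_, ?_⟩
  · refine tendsto_nhds_unique (hq t₀ le_rfl) ?_
    simp only [hQ0]; exact tendsto_const_nhds
  · refine tendsto_nhds_unique (hp t₀ le_rfl) ?_
    simp only [hP0]; exact tendsto_const_nhds
  · intro T hT
    obtain ⟨L, hL, h⟩ := hfam T hT
    refine ⟨L, hL, fun s hs u hu => ⟨?_, ?_⟩⟩
    · refine le_of_tendsto ((hq s hs.1).sub (hq u hu.1)).abs ?_
      filter_upwards [hU h] with n hn
      exact (hn.1 s hs u hu).1
    · refine le_of_tendsto ((hp s hs.1).sub (hp u hu.1)).abs ?_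
      filter_upwards [hU h] with n hn
      exact (hn.1 s hs u hu).2
  intro t ht dq dp hdq hdp
  -- local uniform control
  have loc : ∀ η > 0, ∃ δ > 0, ∀ᶠ n in (U : Filter ℕ), ∀ s ∈ Icc t (t + δ),
      |s - t| < η ∧ |Q n s - q t| < η ∧ |P n s - p t| < η ∧ HasDerivAt (Q n) (P n s) s ∧
          HasDerivAt (P n) (hRHS l g μ a (Q n s) (P n s) s (clamp 1 (n * P n s))) s := by
    intro η hη
    obtain ⟨L, hL, h⟩ := hfam (t - t₀ + 1) (by linarith)
    have hδ0 : 0 < η / (2 * (L + 1)) := by positivity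
    have hδ2 : (L + 1) * (η / (2 * (L + 1))) = η / 2 := by field_simp
    set δ := min (1 / 2) (η / (2 * (L + 1))) with hδ
    have hδp : 0 < δ := lt_min (by norm_num) hδ0
    have hδh : δ ≤ 1 / 2 := min_le_left _ _
    have hδ3 : (L + 1) * δ ≤ η / 2 := by
      rw [← hδ2]; gcongr; exact min_le_right _ _
    refine ⟨δ, hδp, ?_⟩
    have n1 : ∀ᶠ n in (U : Filter ℕ), |Q n t - q t| < η / 2 := by
      have := Metric.tendsto_nhds.1 (hq t ht.le) (η / 2) (by positivity)
      simpa [Real.dist_eq] using this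
    have n2 : ∀ᶠ n in (U : Filter ℕ), |P n t - p t| < η / 2 := by
      have := Metric.tendsto_nhds.1 (hp t ht.le) (η / 2) (by positivity)
      simpa [Real.dist_eq] using this
    filter_upwards [hU h, n1, n2] with n hn hn1 hn2 s hs
    have hst : |s - t| ≤ δ := by rw [abs_of_nonneg] <;> linarith [hs.1, hs.2]
    have hLs : L * |s - t| ≤ L * δ := by gcongr
    have hsI : s ∈ Icc t₀ (t₀ + (t - t₀ + 1)) := ⟨by linarith [hs.1], by linarith [hs.2]⟩
    obtain ⟨b1, b2⟩ := hn.1 s hsI t ⟨ht.le, by linarith⟩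
    refine ⟨by nlinarith, ?_, ?_, hn.2 s ⟨by linarith [hs.1], by linarith [hs.2]⟩⟩
    · have := abs_sub_le (Q n s) (Q n t) (q t)
      nlinarith
    · have := abs_sub_le (P n s) (P n t) (p t)
      nlinarith
  have hdq' : dq = p t := by
    apply le_antisymm
    · refine deriv_le_of_lim hdq (fun s hs => hq s (ht.le.trans hs)) fun ε hε => ?_
      obtain ⟨δ, hδ, h⟩ := loc ε hε
      refine ⟨δ, hδ, ?_⟩
      filter_upwards [h] with n hn s hs
      obtain ⟨-, -, h3, h4, -⟩ := hn s hs
      exact ⟨_, h4, by linarith [(abs_lt.1 h3).2]⟩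
    · refine deriv_ge_of_lim hdq (fun s hs => hq s (ht.le.trans hs)) fun ε hε => ?_
      obtain ⟨δ, hδ, h⟩ := loc ε hε
      refine ⟨δ, hδ, ?_⟩
      filter_upwards [h] with n hn s hs
      obtain ⟨-, -, h3, h4, -⟩ := hn s hs
      exact ⟨_, h4, by linarith [(abs_lt.1 h3).1]⟩
  have hcont : ∀ σ : ℝ, ∀ ε > 0, ∃ η > 0, ∀ s x y, |s - t| < η → |x - q t| < η → |y - p t| < η →
      |hRHS l g μ a x y s σ - hRHS l g μ a (q t) (p t) t σ| < ε := by
    intro σ ε hε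
    have hc : Continuous (fun z : ℝ × ℝ × ℝ => hRHS l g μ a z.1 z.2.1 z.2.2 σ) := by
      have := ha.continuous
      unfold hRHS
      fun_prop
    obtain ⟨η, hη, h⟩ := Metric.continuousAt_iff.1 (hc.continuousAt (x := (q t, p t, t))) ε hε
    refine ⟨η, hη, fun s x y h1 h2 h3 => ?_⟩
    have := @h (x, y, s) (by
      simp only [Prod.dist_eq, Real.dist_eq]
      exact max_lt h2 (max_lt h3 h1))
    simpa [Real.dist_eq] using this
  have key : ∀ σ₁ σ₂ : ℝ, (∃ η > 0, ∀ᶠ n : ℕ in (U : Filter ℕ), ∀ y, |y - p t| < η →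
      clamp 1 (n * y) ∈ Icc σ₁ σ₂) →
      dp ∈ Icc (hRHS l g μ a (q t) (p t) t σ₂) (hRHS l g μ a (q t) (p t) t σ₁) := by
    rintro σ₁ σ₂ ⟨η, hη, hσ⟩
    constructor
    · refine deriv_ge_of_lim hdp (fun s hs => hp s (ht.le.trans hs)) fun ε hε => ?_
      obtain ⟨η', hη', hc⟩ := hcont σ₂ ε hε
      obtain ⟨δ, hδ, h⟩ := loc (min η η') (lt_min hη hη')
      refine ⟨δ, hδ, ?_⟩
      filter_upwards [h, hσ] with n hn hσ s hs
      obtain ⟨h1, h2, h3, -, h5⟩ := hn s hs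
      refine ⟨_, h5, ?_⟩
      have e1 := hc s (Q n s) (P n s) (h1.trans_le (min_le_right _ _))
        (h2.trans_le (min_le_right _ _)) (h3.trans_le (min_le_right _ _))
      have e2 := hRHS_anti hl hμ g a (Q n s) (P n s) s
        (hσ (P n s) (h3.trans_le (min_le_left _ _))).2
      linarith [(abs_lt.1 e1).1]
    · refine deriv_le_of_lim hdp (fun s hs => hp s (ht.le.trans hs)) fun ε hε => ?_
      obtain ⟨η', hη', hc⟩ := hcont σ₁ ε hε
      obtain ⟨δ, hδ, h⟩ := loc (min η η') (lt_min hη hη')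
      refine ⟨δ, hδ, ?_⟩
      filter_upwards [h, hσ] with n hn hσ s hs
      obtain ⟨h1, h2, h3, -, h5⟩ := hn s hs
      refine ⟨_, h5, ?_⟩
      have e1 := hc s (Q n s) (P n s) (h1.trans_le (min_le_right _ _))
        (h2.trans_le (min_le_right _ _)) (h3.trans_le (min_le_right _ _))
      have e2 := hRHS_anti hl hμ g a (Q n s) (P n s) s
        (hσ (P n s) (h3.trans_le (min_le_left _ _))).1
      linarith [(abs_lt.1 e1).2]
  have hlarge : 0 < |p t| → ∀ᶠ n : ℕ in (U : Filter ℕ), 1 ≤ (n : ℝ) * (|p t| / 2) := fun h0 => by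
    have e : ∀ᶠ n : ℕ in atTop, 2 / |p t| ≤ n := tendsto_natCast_atTop_atTop.eventually_ge_atTop _
    filter_upwards [hU e] with n hn
    rw [div_le_iff₀ h0] at hn
    linarith
  rcases lt_trichotomy (p t) 0 with hpt | hpt | hpt
  · have hk := key (-1) (-1) ⟨|p t| / 2, by have := abs_pos.2 hpt.ne; positivity, by
      filter_upwards [hlarge (abs_pos.2 hpt.ne)] with n hn y hy
      have n0 : (0 : ℝ) ≤ n := Nat.cast_nonneg n
      rw [abs_of_neg hpt] at hy hn
      have := mul_le_mul_of_nonneg_left (show y ≤ -(-p t / 2) by linarith [(abs_lt.1 hy).2]) n0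
      rw [clamp_eq_bot (by linarith)]
      simp⟩
    rw [Icc_self, mem_singleton_iff] at hk
    rw [Phi, if_pos hpt.ne, mem_singleton_iff, hdq', hk, abs_of_neg hpt, div_neg, div_self hpt.ne]
  · have hk := key (-1) 1 ⟨1, one_pos, Eventually.of_forall fun n y _ =>
      abs_le.1 (clamp_abs_le zero_le_one _)⟩
    rw [hpt] at hk
    have hc : ContinuousOn (fun σ => hRHS l g μ a (q t) 0 t σ) (Icc (-1) 1) := by
      unfold hRHS
      fun_prop
    obtain ⟨σ, hσ, he⟩ := intermediate_value_Icc' (by norm_num) hc hk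
    rw [Phi, if_neg (by simpa using hpt)]
    exact ⟨σ, hσ, by rw [hdq', hpt]; simp only at he; rw [he]⟩
  · have hk := key 1 1 ⟨|p t| / 2, by have := abs_pos.2 hpt.ne'; positivity, by
      filter_upwards [hlarge (abs_pos.2 hpt.ne')] with n hn y hy
      have n0 : (0 : ℝ) ≤ n := Nat.cast_nonneg n
      rw [abs_of_pos hpt] at hy hn
      have := mul_le_mul_of_nonneg_left (show p t / 2 ≤ y by linarith [(abs_lt.1 hy).1]) n0
      rw [clamp_eq_top zero_le_one (by linarith)]
      simp⟩
    rw [Icc_self, mem_singleton_iff] at hk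
    rw [Phi, if_pos hpt.ne', mem_singleton_iff, hdq', hk, abs_of_pos hpt, div_self hpt.ne']

/-- Locally Lipschitz on `[t₀, ∞)`, frozen before `t₀`: absolutely continuous everywhere. -/
lemma ac_of_lip (f : ℝ → ℝ) (t₀ : ℝ)
    (h : ∀ T : ℝ, 0 ≤ T → ∃ L : ℝ, 0 ≤ L ∧ ∀ s ∈ Icc t₀ (t₀ + T), ∀ u ∈ Icc t₀ (t₀ + T),
      |f s - f u| ≤ L * |s - u|) (b c : ℝ) :
    AbsolutelyContinuousOnInterval (fun s => f (max s t₀)) b c := by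
  obtain ⟨L, hL, hf⟩ := h (|b - t₀| + |c - t₀|) (by positivity)
  apply LipschitzOnWith.absolutelyContinuousOnInterval (K := ⟨L, hL⟩)
  apply LipschitzOnWith.of_dist_le_mul
  have hm : ∀ x ∈ uIcc b c, max x t₀ ∈ Icc t₀ (t₀ + (|b - t₀| + |c - t₀|)) := by
    intro x hx
    refine ⟨le_max_right _ _, max_le (hx.2.trans ?_) (by
      linarith [abs_nonneg (b - t₀), abs_nonneg (c - t₀)])⟩
    apply max_le
    · linarith [le_abs_self (b - t₀), abs_nonneg (c - t₀)]
    · linarith [le_abs_self (c - t₀), abs_nonneg (b - t₀)]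
  intro x hx y hy
  rw [Real.dist_eq, Real.dist_eq]
  refine (hf _ (hm x hx) _ (hm y hy)).trans ?_
  show L * _ ≤ L * _
  refine mul_le_mul_of_nonneg_left ?_ hL
  refine (abs_max_sub_max_le_max x t₀ y t₀).trans (le_of_eq ?_)
  rw [sub_self, abs_zero, max_eq_left (abs_nonneg _)]

lemma loc_int (f : ℝ → ℝ) (h : ∀ b c, AbsolutelyContinuousOnInterval f b c) :
    LocallyIntegrable (deriv f) volume := by
  intro x
  refine ⟨Icc (x - 1) (x + 1), Icc_mem_nhds (by linarith) (by linarith), ?_⟩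
  rw [← intervalIntegrable_iff_integrableOn_Icc_of_le (by linarith)]
  exact (h _ _).intervalIntegrable_deriv

lemma ae_diff (f : ℝ → ℝ) (h : ∀ b c, AbsolutelyContinuousOnInterval f b c) :
    ∀ᵐ t : ℝ, DifferentiableAt ℝ f t := by
  have : ∀ᵐ t : ℝ, ∀ n : ℕ, t ∈ uIcc (-(n : ℝ)) n → DifferentiableAt ℝ f t :=
    ae_all_iff.2 fun n => (h _ _).ae_differentiableAt
  filter_upwards [this] with t ht
  obtain ⟨n, hn⟩ := exists_nat_ge |t|
  have h2 := abs_le.1 hn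
  exact ht n (by rw [uIcc_of_le (by linarith [h2.1, h2.2])]; exact h2)

/-- **Global existence for the pendulum differential inclusion.** For every initial
condition `(q₀, p₀)` and initial time `t₀` there is a solution of
`(q̇, ṗ) ∈ Φ (q, p, t)` defined on all of `[t₀, ∞)` with `(q, p) (t₀) = (q₀, p₀)`. -/
theorem stmt9 (l g μ : ℝ) (hl : 0 < l) (hg : 0 < g) (hμ : 0 < μ)
    (a : ℝ → ℝ) (K : NNReal) (ha : LipschitzWith K a) :
    ∀ q₀ p₀ t₀ : ℝ, ∃ x : ℝ → ℝ × ℝ,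
      x t₀ = (q₀, p₀) ∧
      IsDISolution (fun z t => Phi l g μ a z.1 z.2 t) (Set.Ici t₀) t₀ x := by
  intro q₀ p₀ t₀
  obtain ⟨q, p, hq0, hp0, hlip, hsol⟩ := exists_limit hl hg hμ a K ha q₀ p₀ t₀
  have acq := ac_of_lip q t₀ (fun T hT => by
    obtain ⟨L, hL, h⟩ := hlip T hT
    exact ⟨L, hL, fun s hs u hu => (h s hs u hu).1⟩)
  have acp := ac_of_lip p t₀ (fun T hT => by
    obtain ⟨L, hL, h⟩ := hlip T hT
    exact ⟨L, hL, fun s hs u hu => (h s hs u hu).2⟩)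
  set q' : ℝ → ℝ := fun s => q (max s t₀) with hq'
  set p' : ℝ → ℝ := fun s => p (max s t₀) with hp'
  refine ⟨fun s => (q' s, p' s), by simp [hq', hp', hq0, hp0],
    fun s => (deriv q' s, deriv p' s), ?_, ?_, ?_⟩
  · intro x
    obtain ⟨s, hs, h1⟩ := loc_int q' acq x
    obtain ⟨s', hs', h2⟩ := loc_int p' acp x
    exact ⟨s ∩ s', inter_mem hs hs', (h1.mono_set inter_subset_left).prodMk
      (h2.mono_set inter_subset_right)⟩
  · intro t ht
    have ht' : t₀ ≤ t := ht
    have i1 := (acq t₀ t).intervalIntegrable_deriv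
    have i2 := (acp t₀ t).intervalIntegrable_deriv
    have e : ∫ s in t₀..t, (deriv q' s, deriv p' s)
        = (∫ s in t₀..t, deriv q' s, ∫ s in t₀..t, deriv p' s) := by
      rw [intervalIntegral.integral_of_le ht', intervalIntegral.integral_of_le ht',
        intervalIntegral.integral_of_le ht']
      exact integral_pair i1.1 i2.1
    rw [e, (acq t₀ t).integral_deriv_eq_sub, (acp t₀ t).integral_deriv_eq_sub]
    simp
  · have hne : ∀ᵐ t : ℝ, t ≠ t₀ := by
      rw [ae_iff]
      simp
    rw [ae_restrict_iff' measurableSet_Ici]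
    filter_upwards [ae_diff q' acq, ae_diff p' acp, hne] with t h1 h2 h3 ht
    have htt : t₀ < t := lt_of_le_of_ne ht (Ne.symm h3)
    have hev : ∀ᶠ s in nhds t, max s t₀ = s := by
      filter_upwards [Ioi_mem_nhds htt] with s hs
      exact max_eq_left (le_of_lt hs)
    have d1 : HasDerivAt q (deriv q' t) t :=
      h1.hasDerivAt.congr_of_eventuallyEq (by
        filter_upwards [hev] with s hs
        simp [hq', hs])
    have d2 : HasDerivAt p (deriv p' t) t :=
      h2.hasDerivAt.congr_of_eventuallyEq (by
        filter_upwards [hev] with s hs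
        simp [hp', hs])
    have := hsol t htt _ _ d1 d2
    simpa only [hq', hp', max_eq_left htt.le] using this
end
end

section
/- Fix constants l > 0, g > 0, μ > 0, a Lipschitz continuous function a : ℝ → ℝ, and an initial time t₀. Then there exist q₀ ∈ [0,π] and p₀ ∈ ℝ such that some solution (q(t),p(t)) of the pendulum differential inclusion (q̇,ṗ) ∈ Φ(q,p,t) on [t₀,∞) with q(t₀) = q₀ and p(t₀) = p₀ satisfies q(t) ∈ [0,π] for all t ≥ t₀ (the inverted pendulum never falls below the horizontal positions). -/
open MeasureTheory Set Filter

noncomputable section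

lemma soft_sgn (y c : ℝ) (hc : 0 ≤ c) : ∃ s ∈ Set.Icc (-1 : ℝ) 1,
    (0 < y - max (-c) (min c y) → s = 1) ∧ (y - max (-c) (min c y) < 0 → s = -1) ∧
    y - max (-c) (min c y) = y - c * s := by
  rcases le_total c y with h | h
  · refine ⟨1, by norm_num, fun _ => rfl, ?_, ?_⟩
    · intro h1
      rw [min_eq_left h, max_eq_right (by linarith)] at h1
      linarith
    · rw [min_eq_left h, max_eq_right (by linarith)]; ring
  · rw [min_eq_right h]
    rcases le_total y (-c) with h2 | h2
    · rw [max_eq_left h2]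
      refine ⟨-1, by norm_num, fun h3 => ?_, fun _ => rfl, by ring⟩
      linarith
    · rw [max_eq_right h2]
      rcases hc.eq_or_lt with h0 | h0
      · refine ⟨0, by norm_num, fun h3 => by linarith, fun h3 => by linarith, ?_⟩
        subst h0; linarith
      · refine ⟨y / c, ⟨?_, ?_⟩, fun h3 => by linarith, fun h3 => by linarith, ?_⟩
        · rw [le_div_iff₀ h0]; linarith
        · rw [div_le_iff₀ h0]; linarith
        · field_simp

/-- Implicit-friction Euler step. -/
def eStep (l g μ : ℝ) (a : ℝ → ℝ) (h t : ℝ) (z : ℝ × ℝ) : ℝ × ℝ :=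
  let q := max 0 (min Real.pi z.1)
  let y := z.2 + h * ((a t / l) * Real.sin q - (g / l) * Real.cos q)
  let c := h * ((μ / l) * |a t * Real.cos q - l * z.2 ^ 2 + g * Real.sin q|)
  let p := y - max (-c) (min c y)
  (z.1 + h * p, p)

def eTraj (l g μ : ℝ) (a : ℝ → ℝ) (t₀ h q₀ : ℝ) : ℕ → ℝ × ℝ
  | 0 => (q₀, 0)
  | k + 1 => eStep l g μ a h (t₀ + k * h) (eTraj l g μ a t₀ h q₀ k)

lemma eTraj_cont (l g μ : ℝ) (a : ℝ → ℝ) (t₀ h : ℝ) (k : ℕ) :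
    Continuous (fun q₀ => eTraj l g μ a t₀ h q₀ k) := by
  induction k with
  | zero => simp only [eTraj]; fun_prop
  | succ k ih =>
    have : Continuous (eStep l g μ a h (t₀ + k * h)) := by
      unfold eStep; fun_prop
    exact this.comp ih

def GoodSeq (l g μ : ℝ) (a : ℝ → ℝ) (t₀ h : ℝ) (N : ℕ) (Q P : ℕ → ℝ) : Prop :=
  P 0 = 0 ∧ (∀ k ≤ N, Q k ∈ Set.Icc 0 Real.pi) ∧
  ∀ k < N, Q (k + 1) = Q k + h * P (k + 1) ∧ ∃ s ∈ Set.Icc (-1 : ℝ) 1,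
    (0 < P (k + 1) → s = 1) ∧ (P (k + 1) < 0 → s = -1) ∧
    P (k + 1) = P k + h * hRHS l g μ a (Q k) (P k) (t₀ + k * h) s

lemma eStep_low (l g μ : ℝ) (hl : 0 < l) (hg : 0 < g) (hμ : 0 < μ) (a : ℝ → ℝ) (h t : ℝ)
    (hh : 0 < h) (z : ℝ × ℝ) (h1 : z.1 ≤ 0) (h2 : z.2 ≤ 0) :
    (eStep l g μ a h t z).1 ≤ z.1 ∧ (eStep l g μ a h t z).2 ≤ 0 := by
  have hp : (eStep l g μ a h t z).2 ≤ 0 := by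
    have hq : max 0 (min Real.pi z.1) = 0 := max_eq_left ((min_le_right _ _).trans h1)
    simp only [eStep, hq, Real.sin_zero, Real.cos_zero]
    set c := h * ((μ / l) * |a t * 1 - l * z.2 ^ 2 + g * 0|) with hc
    have hc0 : 0 ≤ c := by positivity
    have hgl : 0 < h * (g / l) := by positivity
    set y := z.2 + h * ((a t / l) * 0 - (g / l) * 1) with hy
    have hy0 : y ≤ 0 := by rw [hy]; linarith
    have : y ≤ max (-c) (min c y) := by
      rw [min_eq_right (by linarith)]; exact le_max_right _ _
    linarith
  refine ⟨?_, hp⟩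
  have : (eStep l g μ a h t z).1 = z.1 + h * (eStep l g μ a h t z).2 := rfl
  rw [this]; nlinarith

lemma eStep_high (l g μ : ℝ) (hl : 0 < l) (hg : 0 < g) (hμ : 0 < μ) (a : ℝ → ℝ) (h t : ℝ)
    (hh : 0 < h) (z : ℝ × ℝ) (h1 : Real.pi ≤ z.1) (h2 : 0 ≤ z.2) :
    z.1 ≤ (eStep l g μ a h t z).1 ∧ 0 ≤ (eStep l g μ a h t z).2 := by
  have hp : 0 ≤ (eStep l g μ a h t z).2 := by
    have hq : max 0 (min Real.pi z.1) = Real.pi := by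
      rw [min_eq_left h1, max_eq_right Real.pi_pos.le]
    simp only [eStep, hq, Real.sin_pi, Real.cos_pi]
    set c := h * ((μ / l) * |a t * -1 - l * z.2 ^ 2 + g * 0|) with hc
    have hc0 : 0 ≤ c := by positivity
    have hgl : 0 < h * (g / l) := by positivity
    set y := z.2 + h * ((a t / l) * 0 - (g / l) * -1) with hy
    have hy0 : 0 ≤ y := by rw [hy]; linarith
    have : max (-c) (min c y) ≤ y := max_le (by linarith) (min_le_right _ _)
    linarith
  refine ⟨?_, hp⟩
  have : (eStep l g μ a h t z).1 = z.1 + h * (eStep l g μ a h t z).2 := rfl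
  rw [this]; nlinarith

lemma exists_good (l g μ : ℝ) (hl : 0 < l) (hg : 0 < g) (hμ : 0 < μ) (a : ℝ → ℝ) (t₀ h : ℝ)
    (hh : 0 < h) (N : ℕ) : ∃ Q P : ℕ → ℝ, GoodSeq l g μ a t₀ h N Q P := by
  have lowInv : ∀ q₀ : ℝ, ∀ i j : ℕ, i ≤ j → (eTraj l g μ a t₀ h q₀ i).1 ≤ 0 →
      (eTraj l g μ a t₀ h q₀ i).2 ≤ 0 →
      (eTraj l g μ a t₀ h q₀ j).1 ≤ (eTraj l g μ a t₀ h q₀ i).1 ∧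
        (eTraj l g μ a t₀ h q₀ j).2 ≤ 0 := by
    intro q₀ i j hij h1 h2
    induction j, hij using Nat.le_induction with
    | base => exact ⟨le_rfl, h2⟩
    | succ j _ ih =>
      have := eStep_low l g μ hl hg hμ a h (t₀ + j * h) hh (eTraj l g μ a t₀ h q₀ j)
        (ih.1.trans h1) ih.2
      exact ⟨this.1.trans ih.1, this.2⟩
  have highInv : ∀ q₀ : ℝ, ∀ i j : ℕ, i ≤ j → Real.pi ≤ (eTraj l g μ a t₀ h q₀ i).1 →
      0 ≤ (eTraj l g μ a t₀ h q₀ i).2 →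
      (eTraj l g μ a t₀ h q₀ i).1 ≤ (eTraj l g μ a t₀ h q₀ j).1 ∧
        0 ≤ (eTraj l g μ a t₀ h q₀ j).2 := by
    intro q₀ i j hij h1 h2
    induction j, hij using Nat.le_induction with
    | base => exact ⟨le_rfl, h2⟩
    | succ j _ ih =>
      have := eStep_high l g μ hl hg hμ a h (t₀ + j * h) hh (eTraj l g μ a t₀ h q₀ j)
        (h1.trans ih.1) ih.2
      exact ⟨ih.1.trans this.1, this.2⟩
  have hpi := Real.pi_pos
  obtain ⟨q₀, hq₀, hmid⟩ : ∃ q₀ ∈ Set.Icc 0 Real.pi,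
      (eTraj l g μ a t₀ h q₀ N).1 = Real.pi / 2 := by
    have hc : ContinuousOn (fun q₀ => (eTraj l g μ a t₀ h q₀ N).1) (Set.Icc 0 Real.pi) :=
      ((eTraj_cont l g μ a t₀ h N).fst).continuousOn
    have := intermediate_value_Icc hpi.le hc
    refine this ⟨?_, ?_⟩
    · have := (lowInv 0 0 N (Nat.zero_le _) le_rfl le_rfl).1
      simp only [eTraj] at this
      linarith
    · have := (highInv Real.pi 0 N (Nat.zero_le _) le_rfl le_rfl).1
      simp only [eTraj] at this
      linarith
  have hfst : ∀ k, (eTraj l g μ a t₀ h q₀ (k+1)).1 =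
    (eTraj l g μ a t₀ h q₀ k).1 + h * (eTraj l g μ a t₀ h q₀ (k+1)).2 := fun k => rfl
  have hin : ∀ k ≤ N, (eTraj l g μ a t₀ h q₀ k).1 ∈ Set.Icc 0 Real.pi := by
    intro k
    induction k with
    | zero => intro _; exact hq₀
    | succ k ih =>
      intro hk
      have h0 := ih (by omega)
      have hf := hfst k
      constructor
      · by_contra hneg
        push Not at hneg
        have hp : (eTraj l g μ a t₀ h q₀ (k+1)).2 ≤ 0 := by
          by_contra hp
          push Not at hp
          nlinarith [h0.1]
        have := (lowInv q₀ (k+1) N hk hneg.le hp).1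
        linarith
      · by_contra hneg
        push Not at hneg
        have hp : 0 ≤ (eTraj l g μ a t₀ h q₀ (k+1)).2 := by
          by_contra hp
          push Not at hp
          nlinarith [h0.2]
        have := (highInv q₀ (k+1) N hk hneg.le hp).1
        linarith
  refine ⟨fun k => (eTraj l g μ a t₀ h q₀ k).1, fun k => (eTraj l g μ a t₀ h q₀ k).2, rfl, hin,
    fun k hk => ⟨hfst k, ?_⟩⟩
  have hi := hin k hk.le
  set z := eTraj l g μ a t₀ h q₀ k with hz
  have hq : max 0 (min Real.pi z.1) = z.1 := by
    rw [min_eq_right hi.2, max_eq_right hi.1]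
  obtain ⟨s, hs, h1, h2, h3⟩ := soft_sgn
    (z.2 + h * ((a (t₀ + k * h) / l) * Real.sin z.1 - (g / l) * Real.cos z.1))
    (h * ((μ / l) * |a (t₀ + k * h) * Real.cos z.1 - l * z.2 ^ 2 + g * Real.sin z.1|))
    (by positivity)
  have he : (eTraj l g μ a t₀ h q₀ (k+1)).2 =
    (z.2 + h * ((a (t₀ + k * h) / l) * Real.sin z.1 - (g / l) * Real.cos z.1)) -
    max (-(h * ((μ / l) * |a (t₀ + k * h) * Real.cos z.1 - l * z.2 ^ 2 + g * Real.sin z.1|)))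
     (min (h * ((μ / l) * |a (t₀ + k * h) * Real.cos z.1 - l * z.2 ^ 2 + g * Real.sin z.1|))
      (z.2 + h * ((a (t₀ + k * h) / l) * Real.sin z.1 - (g / l) * Real.cos z.1))) := by
    simp only [eTraj, eStep, ← hz, hq]
  rw [← he] at h1 h2 h3
  refine ⟨s, hs, h1, h2, ?_⟩
  show (eTraj l g μ a t₀ h q₀ (k+1)).2 = _
  rw [h3]; unfold hRHS; ring

lemma good_bound (l g μ : ℝ) (hl : 0 < l) (hg : 0 < g) (hμ : 0 < μ) (a : ℝ → ℝ) (K : NNReal)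
    (ha : LipschitzWith K a) (t₀ T : ℝ) (hT : 0 ≤ T) : ∃ L > 0, ∀ h > 0, ∀ N Q P,
    GoodSeq l g μ a t₀ h N Q P →
    (∀ k ≤ N, k * h ≤ T → |P k| ≤ L) ∧
    (∀ k < N, (k + 1) * h ≤ T → |Q (k+1) - Q k| ≤ h * L ∧ |P (k+1) - P k| ≤ h * L) := by
  set A := |a t₀| + K * T with hA
  have hA0 : 0 ≤ A := by positivity
  have haA : ∀ t, |t - t₀| ≤ T → |a t| ≤ A := by
    intro t ht
    have h1 := ha.dist_le_mul t t₀
    rw [Real.dist_eq, Real.dist_eq] at h1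
    have h2 : (K : ℝ) * |t - t₀| ≤ K * T := by gcongr
    have h3 := abs_sub_abs_le_abs_sub (a t) (a t₀)
    linarith
  set R := T * ((A + g) / l) with hR
  have hR0 : 0 ≤ R := by positivity
  set M := (A + g) / l + (μ / l) * (A + l * R ^ 2 + g) with hM
  have hM0 : 0 ≤ M := by positivity
  have hE : ∀ q t, |t - t₀| ≤ T → |(a t / l) * Real.sin q - (g / l) * Real.cos q| ≤ (A + g) / l := by
    intro q t ht
    have e : (a t / l) * Real.sin q - (g / l) * Real.cos q =
      (a t * Real.sin q - g * Real.cos q) / l := by ring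
    rw [e, abs_div, abs_of_pos hl]
    gcongr
    calc _ ≤ |a t * Real.sin q| + |g * Real.cos q| := abs_sub _ _
      _ ≤ A * 1 + g * 1 := by
        rw [abs_mul, abs_mul, abs_of_pos hg]
        gcongr
        · exact haA t ht
        · exact Real.abs_sin_le_one q
        · exact Real.abs_cos_le_one q
      _ = _ := by ring
  refine ⟨R + M + 1, by positivity, fun h hh N Q P ⟨h0, hQ, hs⟩ => ?_⟩
  have htime : ∀ k : ℕ, (k:ℝ) * h ≤ T → |t₀ + k * h - t₀| ≤ T := by
    intro k hk
    have : 0 ≤ (k:ℝ) * h := by positivity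
    rw [add_sub_cancel_left, abs_of_nonneg this]; exact hk
  have hPb : ∀ k ≤ N, (k:ℝ) * h ≤ T → |P k| ≤ k * h * ((A + g) / l) := by
    intro k
    induction k with
    | zero => intro _ _; simp [h0]
    | succ k ih =>
      intro hk hkT
      push_cast at hkT ⊢
      have hkT' : (k:ℝ) * h ≤ T := by nlinarith
      have ih' := ih (by omega) hkT'
      obtain ⟨_, s, hs1, hp, hn, he⟩ := hs k (by omega)
      have hEb := abs_le.1 (hE (Q k) _ (htime k hkT'))
      have hc : 0 ≤ (μ / l) * |a (t₀ + k * h) * Real.cos (Q k) - l * P k ^ 2 + g * Real.sin (Q k)| := by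
        positivity
      unfold hRHS at he
      have ih2 := abs_le.1 ih'
      rw [abs_le]
      have hnn : 0 ≤ ((k:ℝ) + 1) * h * ((A + g) / l) := by positivity
      constructor
      · rcases lt_or_ge (P (k+1)) 0 with hlt | hge
        · rw [hn hlt] at he
          rw [he]; nlinarith
        · linarith
      · rcases lt_or_ge 0 (P (k+1)) with hlt | hge
        · rw [hp hlt] at he
          rw [he]; nlinarith
        · linarith
  have hPR : ∀ k ≤ N, (k:ℝ) * h ≤ T → |P k| ≤ R := by
    intro k hk hkT
    refine (hPb k hk hkT).trans ?_
    rw [hR]; gcongr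
  refine ⟨fun k hk hkT => (hPR k hk hkT).trans (by linarith), fun k hk hkT => ?_⟩
  have hkT' : (k:ℝ) * h ≤ T := by nlinarith
  obtain ⟨hq, s, hs1, hp, hn, he⟩ := hs k hk
  constructor
  · rw [hq, add_sub_cancel_left, abs_mul, abs_of_pos hh]
    gcongr
    exact (hPR (k+1) hk (by push_cast; exact hkT)).trans (by linarith)
  · rw [he, add_sub_cancel_left, abs_mul, abs_of_pos hh]
    gcongr
    have hcb : |a (t₀ + k * h) * Real.cos (Q k) - l * P k ^ 2 + g * Real.sin (Q k)| ≤
        A + l * R ^ 2 + g := by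
      calc _ ≤ |a (t₀ + k * h) * Real.cos (Q k)| + |l * P k ^ 2| + |g * Real.sin (Q k)| := by
            refine (abs_add_le _ _).trans ?_
            gcongr
            exact abs_sub _ _
        _ ≤ A * 1 + l * R ^ 2 + g * 1 := by
          rw [abs_mul, abs_mul, abs_mul, abs_of_pos hg, abs_of_pos hl, abs_pow]
          gcongr
          · exact haA _ (htime k hkT')
          · exact Real.abs_cos_le_one _
          · exact hPR k hk.le hkT'
          · exact Real.abs_sin_le_one _
        _ = _ := by ring
    have : |hRHS l g μ a (Q k) (P k) (t₀ + k * h) s| ≤ M := by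
      have e : hRHS l g μ a (Q k) (P k) (t₀ + k * h) s =
        ((a (t₀ + k * h) / l) * Real.sin (Q k) - (g / l) * Real.cos (Q k)) -
        (μ / l) * |a (t₀ + k * h) * Real.cos (Q k) - l * P k ^ 2 + g * Real.sin (Q k)| * s := by
        unfold hRHS; ring
      rw [e]
      refine (abs_sub _ _).trans ?_
      rw [hM]
      gcongr
      · exact hE _ _ (htime k hkT')
      · rw [abs_mul, abs_mul, abs_abs, abs_of_pos (div_pos hμ hl)]
        calc _ ≤ μ / l * (A + l * R ^ 2 + g) * 1 := by
              gcongr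
              exact abs_le.2 hs1
          _ = _ := by ring
    linarith

/-- index of the grid point below time `t`. -/
def kIdx (t₀ : ℝ) (n : ℕ) (t : ℝ) : ℕ := ⌊(t - t₀) * ((n : ℝ) + 1)⌋₊

lemma kIdx_mono (t₀ : ℝ) (n : ℕ) {s t : ℝ} (h : s ≤ t) : kIdx t₀ n s ≤ kIdx t₀ n t := by
  unfold kIdx; gcongr

lemma kIdx_tendsto (t₀ t : ℝ) (ht : t₀ ≤ t) :
    Tendsto (fun n : ℕ => (kIdx t₀ n t : ℝ) * (1 / ((n : ℝ) + 1))) atTop (nhds (t - t₀)) := by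
  have h1 := tendsto_nat_floor_mul_div_atTop (R := ℝ) (sub_nonneg.2 ht)
  have h2 : Tendsto (fun n : ℕ => (n : ℝ) + 1) atTop atTop :=
    tendsto_atTop_add_const_right _ _ tendsto_natCast_atTop_atTop
  refine (h1.comp h2).congr fun n => ?_
  simp [kIdx, div_eq_mul_inv]

lemma kIdx_le (t₀ t : ℝ) (ht : t₀ ≤ t) (n : ℕ) :
    (kIdx t₀ n t : ℝ) * (1 / ((n : ℝ) + 1)) ≤ t - t₀ := by
  have h0 : (0:ℝ) < (n:ℝ) + 1 := by positivity
  have := Nat.floor_le (a := (t - t₀) * ((n : ℝ) + 1)) (mul_nonneg (sub_nonneg.2 ht) h0.le)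
  rw [mul_one_div, div_le_iff₀ h0]
  exact this

lemma inc_sum (u : ℕ → ℝ) (h A B : ℝ) (i j : ℕ) (hij : i ≤ j)
    (H : ∀ k, i ≤ k → k < j → h * A ≤ u (k+1) - u k ∧ u (k+1) - u k ≤ h * B) :
    ((j:ℝ) * h - i * h) * A ≤ u j - u i ∧ u j - u i ≤ ((j:ℝ) * h - i * h) * B := by
  induction j, hij using Nat.le_induction with
  | base => simp
  | succ j hj ih =>
    have h1 := ih fun k hk hk' => H k hk (by omega)
    have h2 := H j hj (by omega)
    push_cast
    constructor <;> nlinarith [h1.1, h1.2, h2.1, h2.2]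

lemma lim_inc (U : Filter ℕ) [U.NeBot] (hU : U ≤ atTop) (u : ℕ → ℕ → ℝ) (t₀ t1 t2 A B x1 x2 : ℝ)
    (h01 : t₀ ≤ t1) (h12 : t1 ≤ t2)
    (H : ∀ᶠ n in U, ∀ k, kIdx t₀ n t1 ≤ k → k < kIdx t₀ n t2 →
      (1 / ((n:ℝ) + 1)) * A ≤ u n (k+1) - u n k ∧ u n (k+1) - u n k ≤ (1 / ((n:ℝ) + 1)) * B)
    (hx1 : Tendsto (fun n => u n (kIdx t₀ n t1)) U (nhds x1))
    (hx2 : Tendsto (fun n => u n (kIdx t₀ n t2)) U (nhds x2)) :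
    (t2 - t1) * A ≤ x2 - x1 ∧ x2 - x1 ≤ (t2 - t1) * B := by
  have hk := ((kIdx_tendsto t₀ t2 (h01.trans h12)).sub (kIdx_tendsto t₀ t1 h01)).mono_left hU
  rw [sub_sub_sub_cancel_right] at hk
  have hx := hx2.sub hx1
  constructor
  · refine le_of_tendsto_of_tendsto (hk.mul_const A) hx ?_
    filter_upwards [H] with n hn
    exact (inc_sum (u n) _ A B _ _ (kIdx_mono t₀ n h12) hn).1
  · refine le_of_tendsto_of_tendsto hx (hk.mul_const B) ?_
    filter_upwards [H] with n hn
    exact (inc_sum (u n) _ A B _ _ (kIdx_mono t₀ n h12) hn).2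

lemma local_close (U : Filter ℕ) (hU : U ≤ atTop) (u : ℕ → ℕ → ℝ) (t₀ τ L x : ℝ)
    (h0 : t₀ ≤ τ) (hL : 0 < L)
    (H : ∀ᶠ n : ℕ in U, ∀ k, k < kIdx t₀ n (τ + 1) →
      |u n (k+1) - u n k| ≤ (1 / ((n:ℝ) + 1)) * L)
    (hx : Tendsto (fun n => u n (kIdx t₀ n τ)) U (nhds x)) (ε : ℝ) (hε : 0 < ε) :
    ∃ δ > 0, ∀ s, τ ≤ s → s ≤ τ + δ → ∀ᶠ n in U, ∀ k, kIdx t₀ n τ ≤ k → k ≤ kIdx t₀ n s →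
      |u n k - x| < ε := by
  refine ⟨min 1 (ε / (4 * L)), by positivity, fun s hs1 hs2 => ?_⟩
  have hs3 : s ≤ τ + 1 := hs2.trans (by gcongr; exact min_le_left _ _)
  have hs4 : s - τ ≤ ε / (4 * L) := by
    have := min_le_right 1 (ε / (4 * L)); linarith
  have hk := ((kIdx_tendsto t₀ s (h0.trans hs1)).sub (kIdx_tendsto t₀ τ h0)).mono_left hU
  rw [sub_sub_sub_cancel_right] at hk
  have hkL := hk.mul_const L
  have hlt : (s - τ) * L < ε / 2 := by
    have : (s - τ) * L ≤ ε / (4 * L) * L := by gcongr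
    have e : ε / (4 * L) * L = ε / 4 := by field_simp
    linarith
  filter_upwards [H, hkL.eventually_lt_const hlt,
    (tendsto_order.1 hx).1 (x - ε / 2) (by linarith),
    (tendsto_order.1 hx).2 (x + ε / 2) (by linarith)] with n hn h1 h2 h3 k hk1 hk2
  have hs := inc_sum (u n) (1 / ((n:ℝ) + 1)) (-L) L _ k hk1 (fun j _ hj => by
    have := abs_le.1 (hn j (hj.trans_le (hk2.trans (kIdx_mono t₀ n hs3))))
    constructor <;> linarith)
  have hc : (k:ℝ) * (1 / ((n:ℝ) + 1)) ≤ kIdx t₀ n s * (1 / ((n:ℝ) + 1)) := by gcongr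
  have hd : ((k:ℝ) * (1 / ((n:ℝ) + 1)) - kIdx t₀ n τ * (1 / ((n:ℝ) + 1))) * L ≤
    (kIdx t₀ n s * (1 / ((n:ℝ) + 1)) - kIdx t₀ n τ * (1 / ((n:ℝ) + 1))) * L := by
    gcongr
  rw [abs_lt]
  constructor <;> linarith [hs.1, hs.2]

lemma deriv_between (u : ℝ → ℝ) (d τ A B : ℝ) (hd : HasDerivAt u d τ)
    (H : ∀ ε > 0, ∃ δ > 0, ∀ s, τ ≤ s → s ≤ τ + δ →
      (s - τ) * (A - ε) ≤ u s - u τ ∧ u s - u τ ≤ (s - τ) * (B + ε)) : A ≤ d ∧ d ≤ B := by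
  have hs : Tendsto (slope u τ) (nhdsWithin τ (Set.Ioi τ)) (nhds d) :=
    (hasDerivAt_iff_tendsto_slope.1 hd).mono_left
      (nhdsWithin_mono _ fun x hx => ne_of_gt hx)
  have key : ∀ ε > 0, A - ε ≤ d ∧ d ≤ B + ε := by
    intro ε hε
    obtain ⟨δ, hδ, h⟩ := H ε hε
    have hev : ∀ᶠ s in nhdsWithin τ (Set.Ioi τ), s ∈ Set.Ioc τ (τ + δ) :=
      Ioc_mem_nhdsGT (by linarith)
    constructor
    · refine ge_of_tendsto hs ?_
      filter_upwards [hev] with s hs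
      have h1 := (h s hs.1.le hs.2).1
      rw [slope_def_field, le_div_iff₀ (sub_pos.2 hs.1)]; linarith
    · refine le_of_tendsto hs ?_
      filter_upwards [hev] with s hs
      have h1 := (h s hs.1.le hs.2).2
      rw [slope_def_field, div_le_iff₀ (sub_pos.2 hs.1)]; linarith
  exact ⟨le_of_forall_sub_le fun ε hε => (key ε hε).1,
    le_of_forall_pos_le_add fun ε hε => (key ε hε).2⟩

lemma ac_of_lip_s10 (u : ℝ → ℝ) (t₀ : ℝ) (h0 : ∀ t ≤ t₀, u t = u t₀)
    (hL : ∀ T, t₀ ≤ T → ∃ L > 0, ∀ s t, t₀ ≤ s → s ≤ t → t ≤ T → |u t - u s| ≤ L * (t - s))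
    (a b : ℝ) : AbsolutelyContinuousOnInterval u a b := by
  obtain ⟨L, hL0, hL⟩ := hL (max t₀ (max a b)) (le_max_left _ _)
  have e : ∀ t, u t = u (max t₀ t) := by
    intro t
    rcases le_total t t₀ with h | h
    · rw [max_eq_left h, h0 t h]
    · rw [max_eq_right h]
  apply LipschitzOnWith.absolutelyContinuousOnInterval (K := L.toNNReal)
  have aux : ∀ x ∈ uIcc a b, ∀ y ∈ uIcc a b, x ≤ y → |u y - u x| ≤ L * |y - x| := by
    intro x hx y hy hxy
    rw [e x, e y]
    refine (hL _ _ (le_max_left _ _) (max_le_max_left _ hxy) (max_le_max_left _ hy.2)).trans ?_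
    gcongr
    rw [abs_of_nonneg (by linarith)]
    rcases le_total t₀ x with h | h <;> rcases le_total t₀ y with h' | h' <;>
      simp [h, h'] <;> linarith
  apply LipschitzOnWith.of_dist_le_mul
  intro x hx y hy
  rw [Real.coe_toNNReal _ hL0.le, Real.dist_eq, Real.dist_eq]
  rcases le_total x y with h | h
  · rw [abs_sub_comm, abs_sub_comm x]; exact aux x hx y hy h
  · exact aux y hy x hx h

lemma hRHS_between (l g μ : ℝ) (hl : 0 < l) (hμ : 0 < μ) (a : ℝ → ℝ) (q p t s : ℝ)
    (hs : s ∈ Set.Icc (-1 : ℝ) 1) :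
    hRHS l g μ a q p t 1 ≤ hRHS l g μ a q p t s ∧
    hRHS l g μ a q p t s ≤ hRHS l g μ a q p t (-1) := by
  unfold hRHS
  have hc : 0 ≤ (μ / l) * |a t * Real.cos q - l * p ^ 2 + g * Real.sin q| := by positivity
  constructor <;> nlinarith [hs.1, hs.2]

lemma mem_Phi (l g μ : ℝ) (hl : 0 < l) (hμ : 0 < μ) (a : ℝ → ℝ) (q p t d : ℝ)
    (h : hRHS l g μ a q p t 1 ≤ d ∧ d ≤ hRHS l g μ a q p t (-1))
    (hp : 0 < p → d = hRHS l g μ a q p t 1) (hn : p < 0 → d = hRHS l g μ a q p t (-1)) :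
    (p, d) ∈ Phi l g μ a q p t := by
  unfold Phi
  rcases lt_trichotomy p 0 with h1 | h1 | h1
  · rw [if_pos h1.ne, abs_of_neg h1, hn h1, div_neg, div_self h1.ne]; rfl
  · subst h1
    rw [if_neg (by simp)]
    have hc : 0 ≤ (μ / l) * |a t * Real.cos q - l * 0 ^ 2 + g * Real.sin q| := by positivity
    unfold hRHS at h ⊢
    set c := (μ / l) * |a t * Real.cos q - l * 0 ^ 2 + g * Real.sin q| with hcd
    rcases hc.eq_or_lt with h0 | h0
    · refine ⟨0, by norm_num, ?_⟩
      rw [← h0] at h ⊢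
      ext
      · rfl
      · simp only; linarith [h.1, h.2]
    · refine ⟨((a t / l) * Real.sin q - (g / l) * Real.cos q - d) / c, ⟨?_, ?_⟩, ?_⟩
      · rw [le_div_iff₀ h0]; linarith [h.2]
      · rw [div_le_iff₀ h0]; linarith [h.1]
      · ext
        · rfl
        · simp only; rw [mul_div_cancel₀ _ h0.ne']; ring
  · rw [if_pos h1.ne', abs_of_pos h1, hp h1, div_self h1.ne']; rfl

lemma assemble (F : ℝ × ℝ → ℝ → Set (ℝ × ℝ)) (q p : ℝ → ℝ) (t₀ : ℝ)
    (hq : ∀ a b, AbsolutelyContinuousOnInterval q a b)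
    (hp : ∀ a b, AbsolutelyContinuousOnInterval p a b)
    (H : ∀ t, t₀ ≤ t → ∀ d e, HasDerivAt q d t → HasDerivAt p e t → (d, e) ∈ F (q t, p t) t) :
    IsDISolution F (Set.Ici t₀) t₀ (fun t => (q t, p t)) := by
  have hli : ∀ u : ℝ → ℝ, (∀ a b, AbsolutelyContinuousOnInterval u a b) →
      LocallyIntegrable (deriv u) volume := by
    intro u hu x
    refine ⟨Set.Icc (x - 1) (x + 1), Icc_mem_nhds (by linarith) (by linarith), ?_⟩
    exact (intervalIntegrable_iff_integrableOn_Icc_of_le (by linarith)).1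
      (hu (x-1) (x+1)).intervalIntegrable_deriv
  have hae : ∀ u : ℝ → ℝ, (∀ a b, AbsolutelyContinuousOnInterval u a b) →
      ∀ᵐ t, DifferentiableAt ℝ u t := by
    intro u hu
    have : ∀ n : ℕ, ∀ᵐ t, t ∈ uIcc (-(n:ℝ)) n → DifferentiableAt ℝ u t :=
      fun n => (hu _ _).ae_differentiableAt
    filter_upwards [ae_all_iff.2 this] with t ht
    obtain ⟨n, hn⟩ := exists_nat_ge |t|
    exact ht n (Set.Icc_subset_uIcc (abs_le.1 hn))
  refine ⟨fun t => (deriv q t, deriv p t), ?_, ?_, ?_⟩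
  · intro x
    obtain ⟨A, hA, hA'⟩ := hli q hq x
    obtain ⟨B, hB, hB'⟩ := hli p hp x
    exact ⟨A ∩ B, inter_mem hA hB,
      (hA'.mono_set Set.inter_subset_left).prodMk (hB'.mono_set Set.inter_subset_right)⟩
  · intro t ht
    have i1 := (hq t₀ t).intervalIntegrable_deriv
    have i2 := (hp t₀ t).intervalIntegrable_deriv
    have e1 := (hq t₀ t).integral_deriv_eq_sub
    have e2 := (hp t₀ t).integral_deriv_eq_sub
    rw [intervalIntegral.integral_of_le ht] at e1 e2 ⊢
    rw [integral_pair i1.1 i2.1, e1, e2]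
    simp
  · rw [ae_restrict_iff' measurableSet_Ici]
    filter_upwards [hae q hq, hae p hp] with t h1 h2 ht
    exact H t ht _ _ h1.hasDerivAt h2.hasDerivAt

lemma main_aux (l g μ : ℝ) (hl : 0 < l) (hg : 0 < g) (hμ : 0 < μ)
    (a : ℝ → ℝ) (K : NNReal) (ha : LipschitzWith K a) (t₀ : ℝ) :
    ∃ q p : ℝ → ℝ, (∀ t, q t ∈ Set.Icc 0 Real.pi) ∧
      IsDISolution (fun z t => Phi l g μ a z.1 z.2 t) (Set.Ici t₀) t₀ (fun t => (q t, p t)) := by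
  have hpos : ∀ n : ℕ, 0 < 1 / ((n:ℝ) + 1) := fun n => by positivity
  choose Q P hG using fun n : ℕ =>
    exists_good l g μ hl hg hμ a t₀ (1 / ((n:ℝ) + 1)) (hpos n) ((n + 1) ^ 2)
  set U : Ultrafilter ℕ := hyperfilter ℕ with hUdef
  have hU : (U : Filter ℕ) ≤ atTop := Nat.hyperfilter_le_atTop
  have hB : ∀ T, t₀ ≤ T → ∃ L > 0, ∀ᶠ n : ℕ in (U : Filter ℕ),
      (∀ k ≤ kIdx t₀ n T, k ≤ (n + 1) ^ 2 ∧ |P n k| ≤ L) ∧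
      (∀ k < kIdx t₀ n T, |Q n (k+1) - Q n k| ≤ (1 / ((n:ℝ) + 1)) * L ∧
        |P n (k+1) - P n k| ≤ (1 / ((n:ℝ) + 1)) * L) := by
    intro T hT
    obtain ⟨L, hL, H⟩ := good_bound l g μ hl hg hμ a K ha t₀ (T - t₀) (sub_nonneg.2 hT)
    refine ⟨L, hL, hU ?_⟩
    filter_upwards [eventually_ge_atTop ⌈T - t₀⌉₊] with n hn
    have hn' : T - t₀ ≤ n := Nat.ceil_le.1 hn
    have hN : kIdx t₀ n T ≤ (n + 1) ^ 2 := by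
      unfold kIdx
      apply Nat.floor_le_of_le
      push_cast
      rw [sq]; gcongr; linarith
    obtain ⟨H1, H2⟩ := H _ (hpos n) _ _ _ (hG n)
    have hkT : ∀ k : ℕ, k ≤ kIdx t₀ n T → (k:ℝ) * (1 / ((n:ℝ) + 1)) ≤ T - t₀ := by
      intro k hk
      refine le_trans ?_ (kIdx_le t₀ T hT n)
      gcongr
    refine ⟨fun k hk => ⟨hk.trans hN, H1 k (hk.trans hN) (hkT k hk)⟩, fun k hk => ?_⟩
    refine H2 k (hk.trans_le hN) ?_
    have := hkT (k+1) hk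
    push_cast at this
    exact this
  have hlimQ : ∀ t, ∃ x ∈ Set.Icc 0 Real.pi,
      Tendsto (fun n => Q n (kIdx t₀ n t)) U (nhds x) := by
    intro t
    obtain ⟨L, hL, H⟩ := hB (max t₀ t) (le_max_left _ _)
    refine (isCompact_Icc (a := (0:ℝ)) (b := Real.pi)).ultrafilter_le_nhds
      (U.map (fun n => Q n (kIdx t₀ n t))) ?_
    rw [le_principal_iff]
    change ∀ᶠ n in (U : Filter ℕ), Q n (kIdx t₀ n t) ∈ Set.Icc 0 Real.pi
    filter_upwards [H] with n hn
    exact (hG n).2.1 _ (hn.1 _ (kIdx_mono t₀ n (le_max_right _ _))).1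
  have hlimP : ∀ t, ∃ x, Tendsto (fun n => P n (kIdx t₀ n t)) U (nhds x) := by
    intro t
    obtain ⟨L, hL, H⟩ := hB (max t₀ t) (le_max_left _ _)
    obtain ⟨x, _, hx⟩ := (isCompact_Icc (a := -L) (b := L)).ultrafilter_le_nhds
      (U.map (fun n => P n (kIdx t₀ n t))) (by
        rw [le_principal_iff]
        change ∀ᶠ n in (U : Filter ℕ), P n (kIdx t₀ n t) ∈ Set.Icc (-L) L
        filter_upwards [H] with n hn
        exact abs_le.1 (hn.1 _ (kIdx_mono t₀ n (le_max_right _ _))).2)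
    exact ⟨x, hx⟩
  choose q hq01 hq using hlimQ
  choose p hp using hlimP
  have hk0 : ∀ n t, t ≤ t₀ → kIdx t₀ n t = kIdx t₀ n t₀ := by
    intro n t ht
    have h1 : (t - t₀) * ((n:ℝ) + 1) ≤ 0 :=
      mul_nonpos_of_nonpos_of_nonneg (by linarith) (by positivity)
    unfold kIdx
    rw [Nat.floor_of_nonpos h1]; simp
  have hq0 : ∀ t ≤ t₀, q t = q t₀ := fun t ht => by
    have := hq t
    simp only [hk0 _ t ht] at this
    exact tendsto_nhds_unique this (hq t₀)
  have hp0 : ∀ t ≤ t₀, p t = p t₀ := fun t ht => by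
    have := hp t
    simp only [hk0 _ t ht] at this
    exact tendsto_nhds_unique this (hp t₀)
  have hLq : ∀ T, t₀ ≤ T → ∃ L > 0, ∀ s t, t₀ ≤ s → s ≤ t → t ≤ T →
      |q t - q s| ≤ L * (t - s) := by
    intro T hT
    obtain ⟨L, hL, H⟩ := hB T hT
    refine ⟨L, hL, fun s t hs hst htT => ?_⟩
    have := lim_inc U hU Q t₀ s t (-L) L _ _ hs hst (by
      filter_upwards [H] with n hn k _ hk
      have := abs_le.1 (hn.2 k (hk.trans_le (kIdx_mono t₀ n htT))).1
      constructor <;> linarith) (hq s) (hq t)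
    rw [abs_le]; constructor <;> linarith
  have hLp : ∀ T, t₀ ≤ T → ∃ L > 0, ∀ s t, t₀ ≤ s → s ≤ t → t ≤ T →
      |p t - p s| ≤ L * (t - s) := by
    intro T hT
    obtain ⟨L, hL, H⟩ := hB T hT
    refine ⟨L, hL, fun s t hs hst htT => ?_⟩
    have := lim_inc U hU P t₀ s t (-L) L _ _ hs hst (by
      filter_upwards [H] with n hn k _ hk
      have := abs_le.1 (hn.2 k (hk.trans_le (kIdx_mono t₀ n htT))).2
      constructor <;> linarith) (hp s) (hp t)
    rw [abs_le]; constructor <;> linarith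
  refine ⟨q, p, hq01, assemble _ q p t₀ (ac_of_lip_s10 q t₀ hq0 hLq) (ac_of_lip_s10 p t₀ hp0 hLp) ?_⟩
  intro τ hτ d e hd he
  -- closeness of the approximations near `τ`
  have hclose : ∀ ε > 0, ∃ δ > 0, ∀ s, τ ≤ s → s ≤ τ + δ → ∀ᶠ n : ℕ in (U : Filter ℕ),
      ∀ k, kIdx t₀ n τ ≤ k → k < kIdx t₀ n s → k < (n + 1) ^ 2 ∧
        |Q n k - q τ| < ε ∧ |P n k - p τ| < ε ∧ |P n (k+1) - p τ| < ε ∧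
        |t₀ + k * (1 / ((n:ℝ) + 1)) - τ| < ε := by
    intro ε hε
    obtain ⟨L, hL, H⟩ := hB (τ + 1) (by linarith)
    obtain ⟨δ1, hδ1, h1⟩ := local_close U hU Q t₀ τ L (q τ) hτ hL
      (by filter_upwards [H] with n hn k hk using (hn.2 k hk).1) (hq τ) ε hε
    obtain ⟨δ2, hδ2, h2⟩ := local_close U hU P t₀ τ L (p τ) hτ hL
      (by filter_upwards [H] with n hn k hk using (hn.2 k hk).2) (hp τ) ε hε
    obtain ⟨δ3, hδ3, h3⟩ := local_close U hU (fun n k => (k:ℝ) * (1 / ((n:ℝ) + 1))) t₀ τ 1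
      (τ - t₀) hτ one_pos
      (by
        refine Eventually.of_forall fun n k _ => ?_
        push_cast
        rw [show ((k:ℝ) + 1) * (1 / ((n:ℝ) + 1)) - k * (1 / ((n:ℝ) + 1)) = 1 / ((n:ℝ) + 1) by ring,
          abs_of_pos (hpos n), mul_one]) ((kIdx_tendsto t₀ τ hτ).mono_left hU) ε hε
    refine ⟨min 1 (min δ1 (min δ2 δ3)), by positivity, fun s hs1 hs2 => ?_⟩
    have m0 : s ≤ τ + 1 := hs2.trans (by gcongr; exact min_le_left _ _)
    have m1 : s ≤ τ + δ1 := hs2.trans (by gcongr; simp)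
    have m2 : s ≤ τ + δ2 := hs2.trans (by gcongr; simp)
    have m3 : s ≤ τ + δ3 := hs2.trans (by gcongr; simp)
    filter_upwards [H, h1 s hs1 m1, h2 s hs1 m2, h3 s hs1 m3] with n hn c1 c2 c3 k hk1 hk2
    refine ⟨?_, c1 k hk1 hk2.le, c2 k hk1 hk2.le, c2 (k+1) (by omega) hk2, ?_⟩
    · have := (hn.1 (k+1) (Nat.succ_le_of_lt (hk2.trans_le (kIdx_mono t₀ n m0)))).1
      omega
    · have := c3 k hk1 hk2.le
      rwa [show (k:ℝ) * (1 / ((n:ℝ) + 1)) - (τ - t₀) = t₀ + k * (1 / ((n:ℝ) + 1)) - τ by ring] at this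
  have hdq : d = p τ := by
    have := deriv_between q d τ (p τ) (p τ) hd (fun ε hε => by
      obtain ⟨δ, hδ, H⟩ := hclose ε hε
      refine ⟨δ, hδ, fun s hs1 hs2 => ?_⟩
      refine lim_inc U hU Q t₀ τ s _ _ _ _ hτ hs1 ?_ (hq τ) (hq s)
      filter_upwards [H s hs1 hs2] with n hn k hk1 hk2
      obtain ⟨c0, c1, c2, c3, c4⟩ := hn k hk1 hk2
      have hc := abs_lt.1 c3
      rw [((hG n).2.2 k c0).1, add_sub_cancel_left]
      have := hpos n
      constructor <;> gcongr <;> linarith)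
    exact le_antisymm this.2 this.1
  have hcont : ∀ σ : ℝ, ∀ ε > 0, ∃ η > 0, ∀ q' p' t', |q' - q τ| < η → |p' - p τ| < η →
      |t' - τ| < η →
      |hRHS l g μ a q' p' t' σ - hRHS l g μ a (q τ) (p τ) τ σ| < ε := by
    intro σ ε hε
    have hac := ha.continuous
    have hc : Continuous (fun w : ℝ × ℝ × ℝ => hRHS l g μ a w.1 w.2.1 w.2.2 σ) := by
      unfold hRHS; fun_prop
    obtain ⟨η, hη, H⟩ := Metric.continuous_iff.1 hc (q τ, p τ, τ) ε hε
    refine ⟨η, hη, fun q' p' t' h1 h2 h3 => ?_⟩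
    have := H (q', p', t') (by
      simp only [Prod.dist_eq, Real.dist_eq]
      exact max_lt h1 (max_lt h2 h3))
    simpa [Real.dist_eq] using this
  -- general statement
  have hgen : ∀ σ1 σ2 ρ : ℝ, 0 < ρ → (∀ x s : ℝ, |x - p τ| < ρ → s ∈ Set.Icc (-1:ℝ) 1 →
      (0 < x → s = 1) → (x < 0 → s = -1) → ∀ q' p' t',
        hRHS l g μ a q' p' t' σ1 ≤ hRHS l g μ a q' p' t' s ∧
        hRHS l g μ a q' p' t' s ≤ hRHS l g μ a q' p' t' σ2) →
      hRHS l g μ a (q τ) (p τ) τ σ1 ≤ e ∧ e ≤ hRHS l g μ a (q τ) (p τ) τ σ2 := by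
    intro σ1 σ2 ρ hρ hσ
    refine deriv_between p e τ _ _ he (fun ε hε => ?_)
    obtain ⟨η1, hη1, k1⟩ := hcont σ1 ε hε
    obtain ⟨η2, hη2, k2⟩ := hcont σ2 ε hε
    obtain ⟨δ, hδ, H⟩ := hclose (min ρ (min η1 η2)) (by positivity)
    refine ⟨δ, hδ, fun s hs1 hs2 => ?_⟩
    refine lim_inc U hU P t₀ τ s _ _ _ _ hτ hs1 ?_ (hp τ) (hp s)
    filter_upwards [H s hs1 hs2] with n hn k hk1 hk2
    obtain ⟨c0, c1, c2, c3, c4⟩ := hn k hk1 hk2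
    obtain ⟨_, s', hs', hpp, hnn, heq⟩ := (hG n).2.2 k c0
    simp only [lt_min_iff] at c1 c2 c3 c4
    have b := hσ _ s' c3.1 hs' hpp hnn (Q n k) (P n k) (t₀ + k * (1 / ((n:ℝ) + 1)))
    have b1 := abs_lt.1 (k1 _ _ _ c1.2.1 c2.2.1 c4.2.1)
    have b2 := abs_lt.1 (k2 _ _ _ c1.2.2 c2.2.2 c4.2.2)
    rw [heq, add_sub_cancel_left]
    have := hpos n
    constructor <;> gcongr <;> linarith [b.1, b.2]
  rw [hdq]
  refine mem_Phi l g μ hl hμ a _ _ _ _ ?_ ?_ ?_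
  · exact hgen 1 (-1) 1 one_pos fun x s _ hs _ _ q' p' t' => hRHS_between l g μ hl hμ a q' p' t' s hs
  · intro hpτ
    have := hgen 1 1 (p τ) hpτ fun x s hx hs h1 _ q' p' t' => by
      rw [h1 (by linarith [(abs_lt.1 hx).1])]; exact ⟨le_rfl, le_rfl⟩
    exact le_antisymm this.2 this.1
  · intro hpτ
    have := hgen (-1) (-1) (-(p τ)) (by linarith) fun x s hx hs _ h1 q' p' t' => by
      rw [h1 (by linarith [(abs_lt.1 hx).2])]; exact ⟨le_rfl, le_rfl⟩
    exact le_antisymm this.2 this.1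

/-- **Existence of a solution without falling.** There are `q₀ ∈ [0, π]` and `p₀` such that
some solution of the pendulum differential inclusion `(q̇, ṗ) ∈ Φ (q, p, t)` on `[t₀, ∞)`
with `q (t₀) = q₀`, `p (t₀) = p₀` satisfies `q (t) ∈ [0, π]` for all `t ≥ t₀`. -/
theorem stmt10 (l g μ : ℝ) (hl : 0 < l) (hg : 0 < g) (hμ : 0 < μ)
    (a : ℝ → ℝ) (K : NNReal) (ha : LipschitzWith K a) (t₀ : ℝ) :
    ∃ q₀ ∈ Set.Icc (0 : ℝ) Real.pi, ∃ p₀ : ℝ, ∃ x : ℝ → ℝ × ℝ,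
      x t₀ = (q₀, p₀) ∧
      IsDISolution (fun z t => Phi l g μ a z.1 z.2 t) (Set.Ici t₀) t₀ x ∧
      ∀ t ≥ t₀, (x t).1 ∈ Set.Icc (0 : ℝ) Real.pi := by
  obtain ⟨q, p, h1, h2⟩ := main_aux l g μ hl hg hμ a K ha t₀
  exact ⟨q t₀, h1 t₀, p t₀, fun t => (q t, p t), rfl, h2, fun t _ => h1 t⟩
end
end

section
/- Fix constants l > 0, g > 0, μ > 0, a Lipschitz continuous function a : ℝ → ℝ, and an initial time t₀, and assume that μ·|a(t)| < g for all t ≥ t₀. Then there exist q₀ ∈ (0,π) and p₀ ∈ ℝ such that some solution (q(t),p(t)) of the pendulum differential inclusion (q̇,ṗ) ∈ Φ(q,p,t) on [t₀,∞) with q(t₀) = q₀ and p(t₀) = p₀ satisfies q(t) ∈ (0,π) for all t ≥ t₀. -/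
open MeasureTheory Set Filter

noncomputable section

def softT (y τ : ℝ) : ℝ := y - max (-τ) (min τ y)

lemma softT_spec (y τ : ℝ) (hτ : 0 ≤ τ) :
    (y - τ ≤ softT y τ) ∧ (softT y τ ≤ y + τ) ∧ (0 < softT y τ → softT y τ = y - τ) ∧
    (softT y τ < 0 → softT y τ = y + τ) ∧ (y ≤ 0 → softT y τ ≤ 0) ∧ (0 ≤ y → 0 ≤ softT y τ) ∧
    (∀ B, 0 ≤ B → |y| ≤ B + τ → |softT y τ| ≤ B) := by
  unfold softT
  rcases le_total τ y with h | h
  · rw [min_eq_left h, max_eq_right (by linarith)]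
    refine ⟨by linarith, by linarith, fun _ => rfl, fun _ => by linarith, fun _ => by linarith,
      fun _ => by linarith, fun B hB hy => ?_⟩
    rw [abs_le] at *; constructor <;> linarith
  · rw [min_eq_right h]
    rcases le_total (-τ) y with h' | h'
    · rw [max_eq_right h']
      refine ⟨by linarith, by linarith, fun _ => by linarith, fun _ => by linarith, fun _ => by linarith,
        fun _ => by linarith, fun B hB hy => ?_⟩
      rw [abs_le] at *; constructor <;> linarith
    · rw [max_eq_left h']
      refine ⟨by linarith, by linarith, fun _ => by linarith, fun _ => by linarith, fun _ => by linarith,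
        fun _ => by linarith, fun B hB hy => ?_⟩
      rw [abs_le] at *; constructor <;> linarith

def trajE (F : ℝ → ℝ → ℝ) (G : ℝ → ℝ → ℝ → ℝ) (t₀ d q₀ : ℝ) : ℕ → ℝ × ℝ
  | 0 => (q₀, 0)
  | (k + 1) =>
    ((trajE F G t₀ d q₀ k).1 + d * softT ((trajE F G t₀ d q₀ k).2 +
        d * F (max 0 (min Real.pi (trajE F G t₀ d q₀ k).1)) (t₀ + k * d))
        (d * G (max 0 (min Real.pi (trajE F G t₀ d q₀ k).1)) (trajE F G t₀ d q₀ k).2 (t₀ + k * d)),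
      softT ((trajE F G t₀ d q₀ k).2 +
        d * F (max 0 (min Real.pi (trajE F G t₀ d q₀ k).1)) (t₀ + k * d))
        (d * G (max 0 (min Real.pi (trajE F G t₀ d q₀ k).1)) (trajE F G t₀ d q₀ k).2 (t₀ + k * d)))

lemma trajE_cont (F : ℝ → ℝ → ℝ) (G : ℝ → ℝ → ℝ → ℝ) (t₀ d : ℝ)
    (hF : Continuous fun z : ℝ × ℝ => F z.1 z.2)
    (hG : Continuous fun z : ℝ × ℝ × ℝ => G z.1 z.2.1 z.2.2) (k : ℕ) :
    Continuous fun q₀ => trajE F G t₀ d q₀ k := by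
  induction k with
  | zero => simp only [trajE]; fun_prop
  | succ k ih =>
    have h1 : Continuous fun q₀ => F (max 0 (min Real.pi (trajE F G t₀ d q₀ k).1)) (t₀ + k * d) :=
      hF.comp (g := fun z : ℝ × ℝ => F z.1 z.2)
        (f := fun q₀ => (max 0 (min Real.pi (trajE F G t₀ d q₀ k).1), (t₀ + k * d))) (by fun_prop)
    have h2 : Continuous fun q₀ => G (max 0 (min Real.pi (trajE F G t₀ d q₀ k).1))
        (trajE F G t₀ d q₀ k).2 (t₀ + k * d) :=
      hG.comp (g := fun z : ℝ × ℝ × ℝ => G z.1 z.2.1 z.2.2)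
        (f := fun q₀ => (max 0 (min Real.pi (trajE F G t₀ d q₀ k).1), (trajE F G t₀ d q₀ k).2,
          (t₀ + k * d))) (by fun_prop)
    simp only [trajE, softT]
    fun_prop

lemma discrete (F : ℝ → ℝ → ℝ) (G : ℝ → ℝ → ℝ → ℝ) (t₀ d C M₁ C₂ : ℝ)
    (hd : 0 < d) (hd1 : d ≤ 1) (hC : 0 ≤ C) (hM₁ : 0 ≤ M₁)
    (hF : Continuous fun z : ℝ × ℝ => F z.1 z.2)
    (hG : Continuous fun z : ℝ × ℝ × ℝ => G z.1 z.2.1 z.2.2)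
    (hF0 : ∀ t ≥ t₀, F 0 t ≤ 0) (hFp : ∀ t ≥ t₀, 0 ≤ F Real.pi t)
    (hFC : ∀ t ≥ t₀, ∀ q, |F q t| ≤ C) (hG0 : ∀ q p t, 0 ≤ G q p t)
    (hGl : ∀ t ≥ t₀, ∀ q p, M₁ ≤ |p| → C ≤ G q p t)
    (hGu : ∀ t ≥ t₀, ∀ q p, |p| ≤ M₁ + C → G q p t ≤ C₂) (N : ℕ) :
    ∃ Q P : ℕ → ℝ, P 0 = 0 ∧ (∀ k, |P k| ≤ M₁ + C) ∧ (∀ k, |P (k+1) - P k| ≤ d * (C + C₂)) ∧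
      (∀ k, Q (k+1) = Q k + d * P (k+1)) ∧
      ∀ k ≤ N, Q k ∈ Icc 0 Real.pi ∧
        d * (F (Q k) (t₀ + k * d) - G (Q k) (P k) (t₀ + k * d)) ≤ P (k+1) - P k ∧
        P (k+1) - P k ≤ d * (F (Q k) (t₀ + k * d) + G (Q k) (P k) (t₀ + k * d)) ∧
        (0 < P (k+1) →
          P (k+1) - P k = d * (F (Q k) (t₀ + k * d) - G (Q k) (P k) (t₀ + k * d))) ∧
        (P (k+1) < 0 →
          P (k+1) - P k = d * (F (Q k) (t₀ + k * d) + G (Q k) (P k) (t₀ + k * d))) := by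
  have ht : ∀ k : ℕ, t₀ + k * d ≥ t₀ := fun k => by
    have : (0:ℝ) ≤ k * d := by positivity
    linarith
  have hpi := Real.pi_pos
  have hlow : ∀ q₀ k, (trajE F G t₀ d q₀ k).1 ≤ 0 → (trajE F G t₀ d q₀ k).2 ≤ 0 := by
    intro q₀ k
    induction k with
    | zero => simp [trajE]
    | succ k ih =>
      intro h
      rcases le_or_gt (trajE F G t₀ d q₀ k).1 0 with h0 | h0
      · simp only [trajE]
        refine (softT_spec _ _ (mul_nonneg hd.le (hG0 _ _ _))).2.2.2.2.1 ?_
        rw [max_eq_left ((min_le_right _ _).trans h0)]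
        have := mul_nonneg hd.le (neg_nonneg.2 (hF0 _ (ht k)))
        have := ih h0
        linarith
      · simp only [trajE] at h ⊢
        by_contra hc
        push Not at hc
        have := mul_pos hd hc
        linarith
  have hhigh : ∀ q₀ k, Real.pi ≤ (trajE F G t₀ d q₀ k).1 → 0 ≤ (trajE F G t₀ d q₀ k).2 := by
    intro q₀ k
    induction k with
    | zero => simp [trajE]
    | succ k ih =>
      intro h
      rcases le_or_gt Real.pi (trajE F G t₀ d q₀ k).1 with h0 | h0
      · simp only [trajE]
        refine (softT_spec _ _ (mul_nonneg hd.le (hG0 _ _ _))).2.2.2.2.2.1 ?_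
        rw [min_eq_left h0, max_eq_right hpi.le]
        have := mul_nonneg hd.le (hFp _ (ht k))
        have := ih h0
        linarith
      · simp only [trajE] at h ⊢
        by_contra hc
        push Not at hc
        have := mul_pos hd (neg_pos.2 hc)
        linarith
  have hQs : ∀ q₀ k, (trajE F G t₀ d q₀ (k+1)).1 =
    (trajE F G t₀ d q₀ k).1 + d * (trajE F G t₀ d q₀ (k+1)).2 := fun q₀ k => rfl
  have hlow' : ∀ q₀ k m, k ≤ m → (trajE F G t₀ d q₀ k).1 ≤ 0 → (trajE F G t₀ d q₀ m).1 ≤ 0 := by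
    intro q₀ k m hkm h0
    induction m, hkm using Nat.le_induction with
    | base => exact h0
    | succ m hm ih =>
      by_contra hc
      push Not at hc
      have h1 := hQs q₀ m
      have h2 : (trajE F G t₀ d q₀ (m+1)).2 ≤ 0 := by
        simp only [trajE]
        refine (softT_spec _ _ (mul_nonneg hd.le (hG0 _ _ _))).2.2.2.2.1 ?_
        rw [max_eq_left ((min_le_right _ _).trans ih)]
        have := mul_nonneg hd.le (neg_nonneg.2 (hF0 _ (ht m)))
        have := hlow _ _ ih
        linarith
      nlinarith
  have hhigh' : ∀ q₀ k m, k ≤ m → Real.pi ≤ (trajE F G t₀ d q₀ k).1 →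
      Real.pi ≤ (trajE F G t₀ d q₀ m).1 := by
    intro q₀ k m hkm h0
    induction m, hkm using Nat.le_induction with
    | base => exact h0
    | succ m hm ih =>
      by_contra hc
      push Not at hc
      have h1 := hQs q₀ m
      have h2 : 0 ≤ (trajE F G t₀ d q₀ (m+1)).2 := by
        simp only [trajE]
        refine (softT_spec _ _ (mul_nonneg hd.le (hG0 _ _ _))).2.2.2.2.2.1 ?_
        rw [min_eq_left ih, max_eq_right hpi.le]
        have := mul_nonneg hd.le (hFp _ (ht m))
        have := hhigh _ _ ih
        linarith
      nlinarith
  obtain ⟨q₀, -, hq⟩ : ∃ q₀ ∈ Icc 0 Real.pi, (trajE F G t₀ d q₀ N).1 = Real.pi / 2 := by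
    have := intermediate_value_Icc hpi.le
      ((continuous_fst.comp (trajE_cont F G t₀ d hF hG N)).continuousOn (s := Icc 0 Real.pi))
    apply this
    constructor
    · have := hlow' 0 0 N (Nat.zero_le _) (by simp [trajE])
      simp only [Function.comp]; linarith
    · have := hhigh' Real.pi 0 N (Nat.zero_le _) (by simp [trajE])
      simp only [Function.comp]; linarith
  have hP : ∀ k, |(trajE F G t₀ d q₀ k).2| ≤ M₁ + C := by
    intro k
    induction k with
    | zero => simp [trajE]; linarith
    | succ k ih =>
      simp only [trajE]
      set z := trajE F G t₀ d q₀ k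
      refine (softT_spec _ _ (mul_nonneg hd.le (hG0 _ _ _))).2.2.2.2.2.2 _ (by linarith) ?_
      refine (abs_add_le _ _).trans ?_
      rw [abs_mul, abs_of_pos hd]
      have h1 := mul_le_mul_of_nonneg_left (hFC _ (ht k) (max 0 (min Real.pi z.1))) hd.le
      rcases le_total M₁ |z.2| with h | h
      · have h2 := mul_le_mul_of_nonneg_left
          (hGl _ (ht k) (max 0 (min Real.pi z.1)) _ h) hd.le
        linarith
      · have h2 := mul_nonneg hd.le (hG0 (max 0 (min Real.pi z.1)) z.2 (t₀ + k * d))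
        have h3 : d * C ≤ C := by nlinarith
        linarith
  refine ⟨fun k => (trajE F G t₀ d q₀ k).1, fun k => (trajE F G t₀ d q₀ k).2, rfl, hP, ?_,
    fun k => rfl, ?_⟩
  · intro k
    simp only [trajE]
    set z := trajE F G t₀ d q₀ k
    obtain ⟨h1, h2, -⟩ := softT_spec (z.2 + d * F (max 0 (min Real.pi z.1)) (t₀ + k * d))
      (d * G (max 0 (min Real.pi z.1)) z.2 (t₀ + k * d)) (mul_nonneg hd.le (hG0 _ _ _))
    have h3 := mul_le_mul_of_nonneg_left (hGu _ (ht k) (max 0 (min Real.pi z.1)) _ (hP k)) hd.le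
    have h4 := abs_le.1 (hFC _ (ht k) (max 0 (min Real.pi z.1)))
    have h5 := mul_le_mul_of_nonneg_left h4.1 hd.le
    have h6 := mul_le_mul_of_nonneg_left h4.2 hd.le
    rw [abs_le]
    constructor <;> linarith
  · intro k hk
    have hm : (trajE F G t₀ d q₀ k).1 ∈ Icc 0 Real.pi := by
      constructor
      · by_contra hc
        have := hlow' q₀ k N hk (not_le.1 hc).le
        linarith
      · by_contra hc
        have := hhigh' q₀ k N hk (not_le.1 hc).le
        linarith
    refine ⟨hm, ?_⟩
    simp only [trajE]
    set z := trajE F G t₀ d q₀ k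
    rw [min_eq_right hm.2, max_eq_right hm.1]
    obtain ⟨h1, h2, h3, h4, -⟩ := softT_spec (z.2 + d * F z.1 (t₀ + k * d))
      (d * G z.1 z.2 (t₀ + k * d)) (mul_nonneg hd.le (hG0 _ _ _))
    refine ⟨by linarith, by linarith, fun h => ?_, fun h => ?_⟩
    · rw [h3 h]; ring
    · rw [h4 h]; ring


def idx (t₀ : ℝ) (n : ℕ) (t : ℝ) : ℕ := ⌊(t - t₀) * (n + 1)⌋₊

lemma idx_mono (t₀ : ℝ) (n : ℕ) {t t' : ℝ} (h : t ≤ t') : idx t₀ n t ≤ idx t₀ n t' := by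
  unfold idx
  apply Nat.floor_mono
  have : (0:ℝ) ≤ n + 1 := by positivity
  nlinarith

lemma idx_diff (t₀ : ℝ) (n : ℕ) {t t' : ℝ} (h : t ≤ t') :
    (idx t₀ n t' : ℝ) - idx t₀ n t ≤ (t' - t) * (n + 1) + 1 := by
  unfold idx
  have hn : (0:ℝ) ≤ n + 1 := by positivity
  have h1 := Nat.lt_floor_add_one ((t - t₀) * ((n:ℝ) + 1))
  rcases le_total 0 ((t' - t₀) * ((n:ℝ) + 1)) with h0 | h0
  · have h2 := Nat.floor_le h0
    linarith
  · rw [Nat.floor_of_nonpos h0]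
    have : (0:ℝ) ≤ ⌊(t - t₀) * ((n:ℝ) + 1)⌋₊ := Nat.cast_nonneg _
    have : 0 ≤ (t' - t) * ((n:ℝ) + 1) := mul_nonneg (by linarith) hn
    push_cast
    linarith

lemma tendsto_d : Tendsto (fun n : ℕ => 1 / ((n:ℝ) + 1)) (hyperfilter ℕ : Filter ℕ) (nhds 0) :=
  tendsto_one_div_add_atTop_nhds_zero_nat.mono_left Nat.hyperfilter_le_atTop

lemma idx_time (t₀ t : ℝ) (ht : t₀ ≤ t) :
    Tendsto (fun n : ℕ => t₀ + (idx t₀ n t : ℝ) * (1 / ((n:ℝ) + 1)))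
      (hyperfilter ℕ : Filter ℕ) (nhds t) := by
  have h1 : Tendsto (fun n : ℕ => t - 1 / ((n:ℝ) + 1)) (hyperfilter ℕ : Filter ℕ) (nhds t) := by
    simpa using tendsto_d.const_sub t
  refine tendsto_of_tendsto_of_tendsto_of_le_of_le h1 tendsto_const_nhds (fun n => ?_) (fun n => ?_)
  · have hn : (0:ℝ) < n + 1 := by positivity
    have := Nat.lt_floor_add_one ((t - t₀) * ((n:ℝ) + 1))
    simp only [idx]
    have h3 : (t - t₀) ≤ ((⌊(t - t₀) * ((n:ℝ) + 1)⌋₊ : ℝ) + 1) * (1 / ((n:ℝ) + 1)) := by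
      rw [mul_one_div, le_div_iff₀ hn]; exact this.le
    linarith
  · have hn : (0:ℝ) < n + 1 := by positivity
    have := Nat.floor_le (mul_nonneg (sub_nonneg.2 ht) hn.le)
    simp only [idx]
    have h3 : (⌊(t - t₀) * ((n:ℝ) + 1)⌋₊ : ℝ) * (1 / ((n:ℝ) + 1)) ≤ t - t₀ := by
      rw [mul_one_div, div_le_iff₀ hn]; exact this
    linarith

lemma sum_le (u : ℕ → ℝ) (c : ℝ) (i j : ℕ) (hij : i ≤ j)
    (h : ∀ k, i ≤ k → k < j → u (k+1) - u k ≤ c) : u j - u i ≤ c * ((j:ℝ) - i) := by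
  induction j, hij using Nat.le_induction with
  | base => simp
  | succ m hm ih =>
    have h1 := ih (fun k h1 h2 => h k h1 (by omega))
    have h2 := h m hm (by omega)
    push_cast
    linarith

lemma sum_abs (u : ℕ → ℝ) (c : ℝ) (i j : ℕ) (hij : i ≤ j)
    (h : ∀ k, |u (k+1) - u k| ≤ c) : |u j - u i| ≤ c * ((j:ℝ) - i) := by
  rw [abs_le]
  have h1 := sum_le u c i j hij (fun k _ _ => (abs_le.1 (h k)).2)
  have h2 := sum_le (fun k => - u k) c i j hij (fun k _ _ => by have := (abs_le.1 (h k)).1; linarith)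
  constructor <;> linarith

lemma limA (u : ℕ → ℕ → ℝ) (L t₀ : ℝ) (hL : 0 ≤ L)
    (hu : ∀ n k, |u n (k+1) - u n k| ≤ 1 / ((n:ℝ) + 1) * L) (x : ℝ → ℝ)
    (hx : ∀ t, Tendsto (fun n => u n (idx t₀ n t)) (hyperfilter ℕ : Filter ℕ) (nhds (x t))) :
    ∀ t t', t ≤ t' → |x t' - x t| ≤ L * (t' - t) := by
  intro t t' h
  have h1 := ((hx t').sub (hx t)).abs
  have h2 : Tendsto (fun n : ℕ => L * (t' - t) + L * (1 / ((n:ℝ) + 1)))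
      (hyperfilter ℕ : Filter ℕ) (nhds (L * (t' - t))) := by
    simpa using (tendsto_d.const_mul L).const_add (L * (t' - t))
  refine le_of_tendsto_of_tendsto' h1 h2 fun n => ?_
  have h3 := sum_abs (u n) _ _ _ (idx_mono t₀ n h) (hu n)
  refine h3.trans ?_
  have hn : (0:ℝ) < n + 1 := by positivity
  have h4 := mul_le_mul_of_nonneg_left (idx_diff t₀ n h) (a := 1 / ((n:ℝ) + 1) * L) (by positivity)
  refine h4.trans (le_of_eq ?_)
  field_simp

lemma limB (u : ℕ → ℕ → ℝ) (L t₀ : ℝ) (hL : 0 ≤ L)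
    (hu : ∀ n k, |u n (k+1) - u n k| ≤ 1 / ((n:ℝ) + 1) * L) (x t : ℝ)
    (hx : Tendsto (fun n => u n (idx t₀ n t)) (hyperfilter ℕ : Filter ℕ) (nhds x))
    (ρ : ℝ) (hρ : 0 < ρ) :
    ∃ r > 0, ∀ t' ∈ Icc t (t + r), ∀ᶠ n in (hyperfilter ℕ : Filter ℕ), ∀ k,
      idx t₀ n t ≤ k → k ≤ idx t₀ n t' + 1 → |u n k - x| < ρ := by
  refine ⟨ρ / (3 * (L + 1)), by positivity, ?_⟩
  intro t' ht'
  have h2 : Tendsto (fun n : ℕ => 2 * L * (1 / ((n:ℝ) + 1)))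
      (hyperfilter ℕ : Filter ℕ) (nhds 0) := by
    simpa using (tendsto_d.const_mul (2 * L))
  have e1 := h2.eventually (gt_mem_nhds (show 0 < ρ / 3 by positivity))
  have e2 := Metric.tendsto_nhds.1 hx (ρ / 3) (by positivity)
  filter_upwards [e1, e2] with n h1 h2 k hk1 hk2
  rw [Real.dist_eq] at h2
  have h3 := sum_abs (u n) _ _ _ hk1 (hu n)
  have hn : (0:ℝ) < n + 1 := by positivity
  have h5 : (k:ℝ) - idx t₀ n t ≤ (t' - t) * (n + 1) + 2 := by
    have := idx_diff t₀ n ht'.1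
    have h6 : (k:ℝ) ≤ idx t₀ n t' + 1 := by exact_mod_cast hk2
    linarith
  have h4 := mul_le_mul_of_nonneg_left h5 (a := 1 / ((n:ℝ) + 1) * L) (by positivity)
  have h7 : 1 / ((n:ℝ) + 1) * L * ((t' - t) * (n + 1) + 2) =
    L * (t' - t) + 2 * L * (1 / ((n:ℝ) + 1)) := by field_simp
  have h8 : L * (t' - t) ≤ ρ / 3 := by
    have h9 : t' - t ≤ ρ / (3 * (L + 1)) := by linarith [ht'.2]
    rw [le_div_iff₀ (by positivity)] at h9
    nlinarith [ht'.1]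
  calc |u n k - x| = |(u n k - u n (idx t₀ n t)) + (u n (idx t₀ n t) - x)| := by ring_nf
    _ ≤ _ := abs_add_le _ _
    _ < ρ := by linarith

lemma limC (u : ℕ → ℕ → ℝ) (t₀ c t t' : ℝ) (x : ℝ → ℝ) (h0 : t₀ ≤ t) (h : t ≤ t')
    (hx : ∀ t, Tendsto (fun n => u n (idx t₀ n t)) (hyperfilter ℕ : Filter ℕ) (nhds (x t)))
    (hc : ∀ᶠ n in (hyperfilter ℕ : Filter ℕ), ∀ k, idx t₀ n t ≤ k → k < idx t₀ n t' →
      u n (k+1) - u n k ≤ 1 / ((n:ℝ) + 1) * c) : x t' - x t ≤ c * (t' - t) := by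
  have h1 := (hx t').sub (hx t)
  have h2 := ((idx_time t₀ t' (h0.trans h)).sub (idx_time t₀ t h0)).const_mul c
  refine le_of_tendsto_of_tendsto h1 h2 ?_
  filter_upwards [hc] with n hn
  refine (sum_le (u n) _ _ _ (idx_mono t₀ n h) hn).trans (le_of_eq ?_)
  ring

lemma limD (u Q P : ℕ → ℕ → ℝ) (t₀ c t L M : ℝ) (x q p : ℝ → ℝ) (h0 : t₀ ≤ t)
    (hL : 0 ≤ L) (hM : 0 ≤ M)
    (hP : ∀ n k, |P n (k+1) - P n k| ≤ 1 / ((n:ℝ) + 1) * L)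
    (hQ : ∀ n k, |Q n (k+1) - Q n k| ≤ 1 / ((n:ℝ) + 1) * M)
    (hx : ∀ t, Tendsto (fun n => u n (idx t₀ n t)) (hyperfilter ℕ : Filter ℕ) (nhds (x t)))
    (hq : ∀ t, Tendsto (fun n => Q n (idx t₀ n t)) (hyperfilter ℕ : Filter ℕ) (nhds (q t)))
    (hp : ∀ t, Tendsto (fun n => P n (idx t₀ n t)) (hyperfilter ℕ : Filter ℕ) (nhds (p t)))
    (hc : ∃ ρ > 0, ∀ n k, k ≤ (n+1)^2 → |Q n k - q t| < ρ → |P n k - p t| < ρ →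
      |P n (k+1) - p t| < ρ → |t₀ + k * (1 / ((n:ℝ) + 1)) - t| < ρ →
      u n (k+1) - u n k ≤ 1 / ((n:ℝ) + 1) * c) :
    ∃ r > 0, ∀ t' ∈ Icc t (t + r), x t' - x t ≤ c * (t' - t) := by
  obtain ⟨ρ, hρ, hc⟩ := hc
  obtain ⟨r1, hr1, H1⟩ := limB Q M t₀ hM hQ (q t) t (hq t) ρ hρ
  obtain ⟨r2, hr2, H2⟩ := limB P L t₀ hL hP (p t) t (hp t) ρ hρ
  obtain ⟨r3, hr3, H3⟩ := limB (fun n k => t₀ + k * (1 / ((n:ℝ) + 1))) 1 t₀ zero_le_one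
    (by
      intro n k
      have : (0:ℝ) ≤ 1 / ((n:ℝ) + 1) := by positivity
      push_cast
      rw [abs_le]; constructor <;> linarith) t t (idx_time t₀ t h0) ρ hρ
  refine ⟨min r1 (min r2 r3), by positivity, fun t' ht' => ?_⟩
  have m1 : t' ∈ Icc t (t + r1) := ⟨ht'.1, ht'.2.trans (by gcongr; exact min_le_left _ _)⟩
  have m2 : t' ∈ Icc t (t + r2) :=
    ⟨ht'.1, ht'.2.trans (by gcongr; exact (min_le_right _ _).trans (min_le_left _ _))⟩
  have m3 : t' ∈ Icc t (t + r3) :=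
    ⟨ht'.1, ht'.2.trans (by gcongr; exact (min_le_right _ _).trans (min_le_right _ _))⟩
  refine limC u t₀ c t t' x h0 ht'.1 hx ?_
  have hN : ∀ᶠ n : ℕ in (hyperfilter ℕ : Filter ℕ), t' - t₀ ≤ n + 1 := by
    apply Nat.hyperfilter_le_atTop
    filter_upwards [eventually_ge_atTop ⌈t' - t₀⌉₊] with n hn
    have := Nat.ceil_le.1 hn
    linarith
  filter_upwards [H1 t' m1, H2 t' m2, H3 t' m3, hN] with n a1 a2 a3 a4 k hk1 hk2
  refine hc n k ?_ (a1 k hk1 (by omega)) (a2 k hk1 (by omega)) (a2 (k+1) (by omega) (by omega))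
    (a3 k hk1 (by omega))
  refine hk2.le.trans ?_
  unfold idx
  apply Nat.floor_le_of_le
  push_cast
  have hn : (0:ℝ) < n + 1 := by positivity
  nlinarith

lemma limE (x : ℝ → ℝ) (x' t c : ℝ) (hd : HasDerivAt x x' t)
    (h : ∃ r > 0, ∀ t' ∈ Icc t (t + r), x t' - x t ≤ c * (t' - t)) : x' ≤ c := by
  obtain ⟨r, hr, h⟩ := h
  have h1 := (hasDerivWithinAt_iff_tendsto_slope' (s := Ioi t) (by simp)).1
    hd.hasDerivWithinAt
  refine le_of_tendsto h1 ?_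
  filter_upwards [Ioo_mem_nhdsGT (show t < t + r by linarith)] with s hs
  rw [slope_def_field, div_le_iff₀ (by linarith [hs.1])]
  exact h s ⟨hs.1.le, hs.2.le⟩

lemma strict_aux (q p : ℝ → ℝ) (t₀ t c : ℝ) (ht : t₀ ≤ t) (hp : Continuous p)
    (hq : ∀ s ≥ t₀, ∀ s' ≥ t₀, q s' - q s = ∫ u in s..s', p u) (hp0 : p t₀ = 0)
    (hq0 : ∀ s ≥ t₀, 0 ≤ q s) (hc : c < 0)
    (h : q t = 0 → p t = 0 → ∃ r > 0, ∀ t' ∈ Icc t (t + r), p t' - p t ≤ c * (t' - t)) :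
    0 < q t := by
  by_contra hcon
  have hqt : q t = 0 := le_antisymm (not_lt.1 hcon) (hq0 t ht)
  have hpt : p t = 0 := by
    rcases ht.eq_or_lt with h1 | h1
    · rw [← h1]; exact hp0
    · have hder : HasDerivAt (fun s => q t₀ + ∫ u in t₀..s, p u) (p t) t :=
        (hp.integral_hasStrictDerivAt t₀ t).hasDerivAt.const_add _
      have hder2 : HasDerivAt q (p t) t := by
        refine hder.congr_of_eventuallyEq ?_
        filter_upwards [lt_mem_nhds h1] with s hs
        have := hq t₀ le_rfl s hs.le
        linarith
      have hmin : IsLocalMin q t := by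
        filter_upwards [lt_mem_nhds h1] with s hs
        rw [hqt]; exact hq0 s hs.le
      exact hmin.hasDerivAt_eq_zero hder2
  obtain ⟨r, hr, h⟩ := h hqt hpt
  have h1 := hq t ht (t + r) (by linarith)
  have h2 : ∫ u in t..(t+r), p u < ∫ u in t..(t+r), (0:ℝ) := by
    apply intervalIntegral.integral_lt_integral_of_continuousOn_of_le_of_exists_lt (by linarith)
      hp.continuousOn continuousOn_const
    · intro s hs
      have := h s ⟨hs.1.le, hs.2⟩
      rw [hpt] at this
      nlinarith [hs.1]
    · refine ⟨t + r, ⟨by linarith, le_rfl⟩, ?_⟩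
      have := h (t + r) ⟨by linarith, le_rfl⟩
      rw [hpt] at this
      nlinarith
  simp at h2
  have := hq0 (t + r) (by linarith)
  linarith

lemma cont_aux (H : ℝ × ℝ × ℝ → ℝ) (hH : Continuous H) (q p t η : ℝ) (hη : 0 < η) :
    ∃ ρ > 0, ∀ q' p' t', |q' - q| < ρ → |p' - p| < ρ → |t' - t| < ρ →
      H (q', p', t') < H (q, p, t) + η := by
  obtain ⟨ρ, hρ, h⟩ := Metric.continuous_iff.1 hH (q, p, t) η hη
  refine ⟨ρ, hρ, fun q' p' t' h1 h2 h3 => ?_⟩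
  have := h (q', p', t') (by
    simp only [Prod.dist_eq, Real.dist_eq]
    exact max_lt h1 (max_lt h2 h3))
  rw [Real.dist_eq] at this
  linarith [(abs_lt.1 this).2]

lemma ultra_lim (u : ℕ → ℝ) (a b : ℝ)
    (h : ∀ᶠ n in (hyperfilter ℕ : Filter ℕ), u n ∈ Icc a b) :
    ∃ x ∈ Icc a b, Tendsto u (hyperfilter ℕ : Filter ℕ) (nhds x) := by
  obtain ⟨x, hx, h⟩ := (isCompact_Icc (a := a) (b := b)).ultrafilter_le_nhds'
    ((hyperfilter ℕ).map u) h
  exact ⟨x, hx, h⟩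

def RB (x : ℝ → ℝ) (t c : ℝ) : Prop := ∃ r > 0, ∀ t' ∈ Icc t (t + r), x t' - x t ≤ c * (t' - t)

lemma lip_of (x : ℝ → ℝ) (L : ℝ) (hL : 0 ≤ L) (h : ∀ t t', t ≤ t' → |x t' - x t| ≤ L * (t' - t)) :
    LipschitzWith (Real.toNNReal L) x := by
  apply LipschitzWith.of_dist_le_mul
  intro s t
  rw [Real.coe_toNNReal _ hL, Real.dist_eq, Real.dist_eq]
  rcases le_total s t with h1 | h1
  · rw [abs_sub_comm, abs_sub_comm s t, abs_of_nonneg (sub_nonneg.2 h1)]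
    exact h _ _ h1
  · rw [abs_of_nonneg (sub_nonneg.2 h1)]
    exact h _ _ h1

lemma exists_limit_s12 (F : ℝ → ℝ → ℝ) (G : ℝ → ℝ → ℝ → ℝ) (t₀ C M₁ C₂ : ℝ)
    (hC : 0 ≤ C) (hM₁ : 0 ≤ M₁) (hC₂ : 0 ≤ C₂)
    (hF : Continuous fun z : ℝ × ℝ => F z.1 z.2)
    (hG : Continuous fun z : ℝ × ℝ × ℝ => G z.1 z.2.1 z.2.2)
    (hF0 : ∀ t ≥ t₀, F 0 t ≤ 0) (hFp : ∀ t ≥ t₀, 0 ≤ F Real.pi t)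
    (hFC : ∀ t ≥ t₀, ∀ q, |F q t| ≤ C) (hG0 : ∀ q p t, 0 ≤ G q p t)
    (hGl : ∀ t ≥ t₀, ∀ q p, M₁ ≤ |p| → C ≤ G q p t)
    (hGu : ∀ t ≥ t₀, ∀ q p, |p| ≤ M₁ + C → G q p t ≤ C₂) :
    ∃ (q p : ℝ → ℝ) (K₁ K₂ : NNReal), p t₀ = 0 ∧ LipschitzWith K₁ q ∧ LipschitzWith K₂ p ∧
      (∀ t, q t ∈ Icc 0 Real.pi) ∧
      ∀ t ≥ t₀, ∀ η > 0,
        RB p t (F (q t) t + G (q t) (p t) t + η) ∧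
        RB (fun s => - p s) t (-(F (q t) t - G (q t) (p t) t) + η) ∧
        (0 < p t → RB p t (F (q t) t - G (q t) (p t) t + η)) ∧
        (p t < 0 → RB (fun s => - p s) t (-(F (q t) t + G (q t) (p t) t) + η)) ∧
        RB q t (p t + η) ∧ RB (fun s => - q s) t (- p t + η) := by
  have hdp : ∀ n : ℕ, 0 < 1 / ((n:ℝ) + 1) := fun n => by positivity
  have H := fun n : ℕ => discrete F G t₀ (1 / ((n:ℝ) + 1)) C M₁ C₂ (hdp n)
    (by rw [div_le_one (by positivity)]; linarith [(Nat.cast_nonneg n : (0:ℝ) ≤ n)]) hC hM₁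
    hF hG hF0 hFp hFC hG0 hGl hGu ((n+1)^2)
  choose Q P hP0 hPM hPs hQs hB using H
  have hQs' : ∀ n k, |Q n (k+1) - Q n k| ≤ 1 / ((n:ℝ) + 1) * (M₁ + C) := by
    intro n k
    rw [hQs n k, add_sub_cancel_left, abs_mul, abs_of_pos (hdp n)]
    exact mul_le_mul_of_nonneg_left (hPM n _) (hdp n).le
  have hidx : ∀ t, ∀ᶠ n in (hyperfilter ℕ : Filter ℕ), idx t₀ n t ≤ (n+1)^2 := by
    intro t
    apply Nat.hyperfilter_le_atTop
    filter_upwards [eventually_ge_atTop ⌈t - t₀⌉₊] with n hn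
    have := Nat.ceil_le.1 hn
    unfold idx
    apply Nat.floor_le_of_le
    push_cast
    have hn : (0:ℝ) < n + 1 := by positivity
    nlinarith
  have e1 := fun t => ultra_lim (fun n => Q n (idx t₀ n t)) 0 Real.pi
    ((hidx t).mono fun n hn => (hB n _ hn).1)
  have e2 := fun t => ultra_lim (fun n => P n (idx t₀ n t)) (-(M₁ + C)) (M₁ + C)
    (Eventually.of_forall fun n => abs_le.1 (hPM n _))
  choose q hq hqt using e1
  choose p hp hpt using e2
  have hL : 0 ≤ C + C₂ := by linarith
  have hM : 0 ≤ M₁ + C := by linarith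
  have cF : Continuous fun z : ℝ × ℝ × ℝ => F z.1 z.2.2 :=
    hF.comp (f := fun z : ℝ × ℝ × ℝ => (z.1, z.2.2)) (by fun_prop)
  refine ⟨q, p, _, _, ?_, lip_of q _ hM (limA Q _ t₀ hM hQs' q hqt),
    lip_of p _ hL (limA P _ t₀ hL hPs p hpt), hq, ?_⟩
  · have h1 : Tendsto (fun n => P n (idx t₀ n t₀)) (hyperfilter ℕ : Filter ℕ) (nhds 0) := by
      simp [idx, hP0]
    exact tendsto_nhds_unique (hpt t₀) h1
  intro t ht η hη
  have D := fun u x c hx hc =>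
    limD u Q P t₀ c t _ _ x q p ht hL hM hPs hQs' hx hqt hpt hc
  obtain ⟨ρ1, hρ1, c1⟩ := cont_aux (fun z => F z.1 z.2.2 + G z.1 z.2.1 z.2.2) (cF.add hG)
    (q t) (p t) t η hη
  obtain ⟨ρ2, hρ2, c2⟩ := cont_aux (fun z => -(F z.1 z.2.2 - G z.1 z.2.1 z.2.2)) (cF.sub hG).neg
    (q t) (p t) t η hη
  obtain ⟨ρ3, hρ3, c3⟩ := cont_aux (fun z => F z.1 z.2.2 - G z.1 z.2.1 z.2.2) (cF.sub hG)
    (q t) (p t) t η hη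
  obtain ⟨ρ4, hρ4, c4⟩ := cont_aux (fun z => -(F z.1 z.2.2 + G z.1 z.2.1 z.2.2)) (cF.add hG).neg
    (q t) (p t) t η hη
  dsimp only at c1 c2 c3 c4
  refine ⟨D P p _ hpt ⟨ρ1, hρ1, ?_⟩, D (fun n k => - P n k) (fun s => - p s) _
    (fun t => (hpt t).neg) ⟨ρ2, hρ2, ?_⟩, fun hpos => D P p _ hpt ⟨min ρ3 (p t), by positivity, ?_⟩,
    fun hneg => D (fun n k => - P n k) (fun s => - p s) _ (fun t => (hpt t).neg)
      ⟨min ρ4 (-p t), lt_min hρ4 (by linarith), ?_⟩,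
    D Q q _ hqt ⟨η, hη, ?_⟩, D (fun n k => - Q n k) (fun s => - q s) _
    (fun t => (hqt t).neg) ⟨η, hη, ?_⟩⟩
  · intro n k hk h1 h2 h3 h4
    have := mul_le_mul_of_nonneg_left (c1 _ _ _ h1 h2 h4).le (hdp n).le
    exact (hB n k hk).2.2.1.trans this
  · intro n k hk h1 h2 h3 h4
    have := mul_le_mul_of_nonneg_left (c2 _ _ _ h1 h2 h4).le (hdp n).le
    have := (hB n k hk).2.1
    linarith
  · intro n k hk h1 h2 h3 h4
    have := mul_le_mul_of_nonneg_left (c3 _ _ _ (h1.trans_le (min_le_left _ _))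
      (h2.trans_le (min_le_left _ _)) (h4.trans_le (min_le_left _ _))).le (hdp n).le
    rw [(hB n k hk).2.2.2.1 (by linarith [(abs_lt.1 (h3.trans_le (min_le_right _ _))).1])]
    exact this
  · intro n k hk h1 h2 h3 h4
    have := mul_le_mul_of_nonneg_left (c4 _ _ _ (h1.trans_le (min_le_left _ _))
      (h2.trans_le (min_le_left _ _)) (h4.trans_le (min_le_left _ _))).le (hdp n).le
    have := (hB n k hk).2.2.2.2 (by linarith [(abs_lt.1 (h3.trans_le (min_le_right _ _))).2])
    linarith
  · intro n k hk h1 h2 h3 h4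
    have := mul_le_mul_of_nonneg_left (show P n (k+1) ≤ p t + η by
      linarith [(abs_lt.1 h3).2]) (hdp n).le
    rw [hQs]; linarith
  · intro n k hk h1 h2 h3 h4
    have := mul_le_mul_of_nonneg_left (show -P n (k+1) ≤ -p t + η by
      linarith [(abs_lt.1 h3).1]) (hdp n).le
    rw [hQs]; linarith

lemma lip_ftc (x : ℝ → ℝ) (K : NNReal) (h : LipschitzWith K x) (s t : ℝ) :
    ∫ u in s..t, deriv x u = x t - x s :=
  (h.lipschitzOnWith.absolutelyContinuousOnInterval).integral_deriv_eq_sub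

lemma lip_int (x : ℝ → ℝ) (K : NNReal) (h : LipschitzWith K x) :
    LocallyIntegrable (deriv x) volume := by
  refine (locallyIntegrable_const (K : ℝ)).mono (measurable_deriv x).aestronglyMeasurable
    (Eventually.of_forall fun t => ?_)
  simpa using norm_deriv_le_of_lipschitz h (x₀ := t)

/-- **A solution strictly above the horizontal positions.** If `μ·|a t| < g` for all
`t ≥ t₀`, then there are `q₀ ∈ (0, π)` and `p₀` such that some solution of the pendulum
differential inclusion `(q̇, ṗ) ∈ Φ (q, p, t)` on `[t₀, ∞)` with `q (t₀) = q₀`,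
`p (t₀) = p₀` satisfies `q (t) ∈ (0, π)` for all `t ≥ t₀`. -/
theorem stmt12 (l g μ : ℝ) (hl : 0 < l) (hg : 0 < g) (hμ : 0 < μ)
    (a : ℝ → ℝ) (K : NNReal) (ha : LipschitzWith K a) (t₀ : ℝ)
    (hsmall : ∀ t ≥ t₀, μ * |a t| < g) :
    ∃ q₀ ∈ Set.Ioo (0 : ℝ) Real.pi, ∃ p₀ : ℝ, ∃ x : ℝ → ℝ × ℝ,
      x t₀ = (q₀, p₀) ∧
      IsDISolution (fun z t => Phi l g μ a z.1 z.2 t) (Set.Ici t₀) t₀ x ∧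
      ∀ t ≥ t₀, (x t).1 ∈ Set.Ioo (0 : ℝ) Real.pi := by
  have hac := ha.continuous
  obtain ⟨A, hA⟩ : ∃ A, A = g / μ := ⟨_, rfl⟩
  have hA0 : 0 < A := by rw [hA]; positivity
  have haA : ∀ t ≥ t₀, |a t| ≤ A := fun t ht => by
    rw [hA, le_div_iff₀ hμ]; linarith [hsmall t ht]
  obtain ⟨B, hBdef⟩ : ∃ B, B = A + g := ⟨_, rfl⟩
  have hB0 : 0 < B := by rw [hBdef]; positivity
  have hs1 : ∀ t ≥ t₀, ∀ x y : ℝ, |x| ≤ 1 → |y| ≤ 1 → |a t * x + g * y| ≤ B := by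
    intro t ht x y hx hy
    refine (abs_add_le _ _).trans ?_
    rw [abs_mul, abs_mul, abs_of_pos hg, hBdef]
    have := haA t ht
    nlinarith [abs_nonneg x, abs_nonneg (a t)]
  obtain ⟨C, hCdef⟩ : ∃ C, C = B / l := ⟨_, rfl⟩
  have hC0 : 0 < C := by rw [hCdef]; positivity
  obtain ⟨M₁, hM₁⟩ : ∃ M₁, M₁ = 1 + C / μ + B / l := ⟨_, rfl⟩
  have hM1 : 1 ≤ M₁ := by
    have : 0 < C / μ := by positivity
    have : 0 < B / l := by positivity
    linarith
  obtain ⟨F, hF⟩ : ∃ F : ℝ → ℝ → ℝ, F = fun q t => (a t / l) * Real.sin q - (g / l) * Real.cos q :=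
    ⟨_, rfl⟩
  obtain ⟨G, hG⟩ : ∃ G : ℝ → ℝ → ℝ → ℝ, G = fun q p t =>
    (μ / l) * |a t * Real.cos q - l * p ^ 2 + g * Real.sin q| := ⟨_, rfl⟩
  have hh : ∀ q p t s, hRHS l g μ a q p t s = F q t - G q p t * s := by
    intro q p t s; rw [hF, hG]; simp only [hRHS]; ring
  obtain ⟨q, p, K₁, K₂, hp0, hqL, hpL, hqI, hR⟩ := exists_limit_s12 F G t₀ C M₁
    ((μ / l) * (B + l * (M₁ + C) ^ 2)) hC0.le (by linarith) (by positivity)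
    (by rw [hF]; fun_prop) (by rw [hG]; fun_prop)
    (by
      intro t ht; rw [hF]; simp; positivity)
    (by
      intro t ht; rw [hF]; simp; positivity)
    (by
      intro t ht q
      have h1 := hs1 t ht (Real.sin q) (-Real.cos q) (Real.abs_sin_le_one q)
        (by rw [abs_neg]; exact Real.abs_cos_le_one q)
      have h2 : F q t = (a t * Real.sin q + g * (-Real.cos q)) / l := by
        rw [hF]; ring
      rw [h2, abs_div, abs_of_pos hl, hCdef]
      gcongr)
    (by intro q p t; rw [hG]; positivity)
    (by
      intro t ht q p hp
      have h1 := hs1 t ht (Real.cos q) (Real.sin q) (Real.abs_cos_le_one q) (Real.abs_sin_le_one q)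
      have h2 : M₁ ≤ p ^ 2 := by rw [← sq_abs]; nlinarith
      have h3 : l * p ^ 2 - B ≤ |a t * Real.cos q - l * p ^ 2 + g * Real.sin q| := by
        rw [le_abs]; right; linarith [(abs_le.1 h1).2]
      have h4 : (μ / l) * (l * M₁ - B) ≤ G q p t := by
        rw [hG]; dsimp only; gcongr
        exact le_trans (by gcongr) h3
      refine le_trans ?_ h4
      have h5 : (μ / l) * (l * M₁ - B) = C + μ := by
        rw [hM₁]; field_simp; ring
      rw [h5]; linarith)
    (by
      intro t ht q p hp
      have h1 := hs1 t ht (Real.cos q) (Real.sin q) (Real.abs_cos_le_one q) (Real.abs_sin_le_one q)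
      have h2 : p ^ 2 ≤ (M₁ + C) ^ 2 := by rw [← sq_abs]; gcongr
      have h2' := mul_le_mul_of_nonneg_left h2 hl.le
      have h2'' : 0 ≤ l * p ^ 2 := by positivity
      rw [hG]; dsimp only; gcongr
      rw [abs_le] at h1 ⊢
      constructor <;> linarith)
  -- derivative facts
  have hderq : ∀ t ≥ t₀, DifferentiableAt ℝ q t → deriv q t = p t := by
    intro t ht hd
    apply le_antisymm
    · refine le_of_forall_pos_le_add fun η hη => ?_
      exact limE q _ t _ hd.hasDerivAt (hR t ht η hη).2.2.2.2.1
    · have : -deriv q t ≤ - p t := le_of_forall_pos_le_add fun η hη =>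
        limE _ _ t _ hd.hasDerivAt.neg (hR t ht η hη).2.2.2.2.2
      linarith
  have hqd := hqL.ae_differentiableAt_real
  have hpd := hpL.ae_differentiableAt_real
  have hqint : ∀ s ≥ t₀, ∀ s' ≥ t₀, q s' - q s = ∫ u in s..s', p u := by
    intro s hs s' hs'
    rw [← lip_ftc q K₁ hqL]
    apply intervalIntegral.integral_congr_ae
    filter_upwards [hqd] with u hu hu'
    refine hderq u ?_ hu
    have := hu'.1
    exact (le_min hs hs').trans this.le
  have hstrict : ∀ t ≥ t₀, q t ∈ Ioo 0 Real.pi := by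
    intro t ht
    have hneg : (μ * |a t| - g) / l < 0 := div_neg_of_neg_of_pos (by linarith [hsmall t ht]) hl
    constructor
    · refine strict_aux q p t₀ t ((μ * |a t| - g) / l / 2) ht hpL.continuous hqint hp0
        (fun s hs => (hqI s).1) (by linarith) ?_
      intro h1 h2
      have := (hR t ht (-((μ * |a t| - g) / l) / 2) (by linarith)).1
      rw [h1, h2] at this
      have e : F 0 t + G 0 0 t + -((μ * |a t| - g) / l) / 2 = (μ * |a t| - g) / l / 2 := by
        rw [hF, hG]; simp; ring
      rw [e] at this
      exact this
    · have := strict_aux (fun s => Real.pi - q s) (fun s => - p s) t₀ t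
        ((μ * |a t| - g) / l / 2) ht hpL.continuous.neg ?_ (by simp [hp0])
        (fun s hs => sub_nonneg.2 (hqI s).2) (by linarith) ?_
      · linarith
      · intro s hs s' hs'
        rw [intervalIntegral.integral_neg, ← hqint s hs s' hs']; ring
      intro h1 h2
      have h1' : q t = Real.pi := by linarith
      have h2' : p t = 0 := by linarith
      have := (hR t ht (-((μ * |a t| - g) / l) / 2) (by linarith)).2.1
      rw [h1', h2'] at this
      have e : -(F Real.pi t - G Real.pi 0 t) + -((μ * |a t| - g) / l) / 2 =
          (μ * |a t| - g) / l / 2 := by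
        rw [hF, hG]; simp; ring
      rw [e] at this
      exact this
  refine ⟨q t₀, hstrict t₀ le_rfl, p t₀, fun t => (q t, p t), rfl, ?_, hstrict⟩
  have iq := lip_int q K₁ hqL
  have ip := lip_int p K₂ hpL
  refine ⟨fun t => (deriv q t, deriv p t), ?_, ?_, ?_⟩
  · intro t
    obtain ⟨s1, hs1, i1⟩ := iq t
    obtain ⟨s2, hs2, i2⟩ := ip t
    exact ⟨s1 ∩ s2, inter_mem hs1 hs2,
      Integrable.prodMk (i1.mono_set inter_subset_left) (i2.mono_set inter_subset_right)⟩
  · intro t ht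
    have j1 : IntervalIntegrable (deriv q) volume t₀ t :=
      (hqL.lipschitzOnWith.absolutelyContinuousOnInterval).intervalIntegrable_deriv
    have j2 : IntervalIntegrable (deriv p) volume t₀ t :=
      (hpL.lipschitzOnWith.absolutelyContinuousOnInterval).intervalIntegrable_deriv
    have ht' : t₀ ≤ t := ht
    have k1 := lip_ftc q K₁ hqL t₀ t
    have k2 := lip_ftc p K₂ hpL t₀ t
    rw [intervalIntegral.integral_of_le ht'] at k1 k2 ⊢
    rw [integral_pair j1.1 j2.1, k1, k2]
    simp
  · rw [ae_restrict_iff' measurableSet_Ici]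
    filter_upwards [hqd, hpd] with t h1 h2 ht
    have ht' : t ≥ t₀ := ht
    have e1 := hderq t ht' h1
    have u1 : deriv p t ≤ F (q t) t + G (q t) (p t) t := le_of_forall_pos_le_add fun η hη =>
      limE p _ t _ h2.hasDerivAt (hR t ht' η hη).1
    have u2 : -deriv p t ≤ -(F (q t) t - G (q t) (p t) t) := le_of_forall_pos_le_add fun η hη =>
      limE _ _ t _ h2.hasDerivAt.neg (hR t ht' η hη).2.1
    have hGn : 0 ≤ G (q t) (p t) t := by rw [hG]; positivity
    rcases lt_trichotomy (p t) 0 with hp | hp | hp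
    · have u3 : -deriv p t ≤ -(F (q t) t + G (q t) (p t) t) := le_of_forall_pos_le_add fun η hη =>
        limE _ _ t _ h2.hasDerivAt.neg ((hR t ht' η hη).2.2.2.1 hp)
      simp only [Phi, if_pos hp.ne, mem_singleton_iff]
      rw [e1, hh, abs_of_neg hp, div_neg, div_self hp.ne]
      congr 1
      linarith
    · simp only [Phi, hp, ne_eq, not_true_eq_false, if_false, mem_setOf_eq]
      rw [hp] at u1 u2 hGn
      rcases hGn.eq_or_lt with h0 | h0
      · refine ⟨0, by simp, ?_⟩
        rw [e1, hh, hp]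
        congr 1
        linarith
      · refine ⟨(F (q t) t - deriv p t) / G (q t) 0 t, ⟨?_, ?_⟩, ?_⟩
        · rw [le_div_iff₀ h0]; linarith
        · rw [div_le_iff₀ h0]; linarith
        · rw [e1, hh, hp, mul_div_cancel₀ _ h0.ne']
          congr 1
          ring
    · have u3 : deriv p t ≤ F (q t) t - G (q t) (p t) t := le_of_forall_pos_le_add fun η hη =>
        limE p _ t _ h2.hasDerivAt ((hR t ht' η hη).2.2.1 hp)
      simp only [Phi, if_pos hp.ne', mem_singleton_iff]
      rw [e1, hh, abs_of_pos hp, div_self hp.ne']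
      congr 1
      linarith
end
end
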